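/- Let m ≥ 2, let q ≥ 2 be an integer, and let Ω be a nonempty closed subset of Σ_m. Then the Hausdorff dimension of Ξ_Ω equals the Minkowski dimension of X_Ω if and only if the tree of prefixes of Ω is spherically symmetric, i.e. for every k ≥ 1 there is a number c_k such that every u ∈ Pref_k(Ω) has exactly c_k one-letter extensions in Pref_{k+1}(Ω). -/

import Mathlib

open scoped Classical ENNReal
open Filter MeasureTheory Topology

noncomputable section

/-- `Begins x u` : the finite word `u` is a prefix of the sequence `x` (indexed by `ℕ+`). -/
def Begins {m : ℕ} (x : ℕ+ → Fin m) (u : List (Fin m)) : Prop :=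
  ∀ j : Fin u.length, x ⟨(j : ℕ) + 1, Nat.succ_pos _⟩ = u.get j

/-- `Cyl u` : the cylinder set of the word `u`. -/
def Cyl {m : ℕ} (u : List (Fin m)) : Set (ℕ+ → Fin m) := {x | Begins x u}

/-- `Pref Ω` : the set of (finite) prefixes of sequences in `Ω`. -/
def Pref {m : ℕ} (Ω : Set (ℕ+ → Fin m)) : Set (List (Fin m)) := {u | ∃ x ∈ Ω, Begins x u}

/-- number of length-`n` words beginning some sequence of `X`. -/
def NWords {m : ℕ} (n : ℕ) (X : Set (ℕ+ → Fin m)) : ℕ :=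
  Set.ncard {u : List (Fin m) | u.length = n ∧ u ∈ Pref X}

/-- restriction of `x` to the geometric progression `J_i = {i, qi, q²i, …}`:
`(x|J_i)_k = x_{q^{k-1} i}` for `k ≥ 1`. -/
def RestrJ {m : ℕ} (q : ℕ+) (x : ℕ+ → Fin m) (i : ℕ+) : ℕ+ → Fin m :=
  fun k => x (q ^ ((k : ℕ) - 1) * i)

/-- the multiplicative subshift `X_Ω = {x : x|J_i ∈ Ω for all i with q ∤ i}`. -/
def XOm {m : ℕ} (q : ℕ+) (Ω : Set (ℕ+ → Fin m)) : Set (ℕ+ → Fin m) :=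
  {x | ∀ i : ℕ+, ¬ q ∣ i → RestrJ q x i ∈ Ω}

/-- the real number `Σ_{k≥1} x_k m^{-k}` with base-`m` digit sequence `x`. -/
def ValMap (m : ℕ) (x : ℕ+ → Fin m) : ℝ := ∑' k : ℕ+, ((x k : ℕ) : ℝ) * (m : ℝ)⁻¹ ^ (k : ℕ)

/-- the subset of `[0,1]` of reals whose base-`m` digit sequence lies in `X`. -/
def XiSet {m : ℕ} (X : Set (ℕ+ → Fin m)) : Set ℝ := {r | ∃ x ∈ X, r = ValMap m x}

/-- entropy (base-`m` logarithms) of the partition of `Ω` into `k`-cylinders, for a measure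
supported on `Ω` (words that are not prefixes of `Ω` get measure `0` and contribute nothing). -/
def Hent (m : ℕ) (μ : Measure (ℕ+ → Fin m)) (k : ℕ) : ℝ :=
  -∑ u : Fin k → Fin m,
    ((μ (Cyl (List.ofFn u))).toReal * Real.logb m (μ (Cyl (List.ofFn u))).toReal)

/-- `s(Ω,μ) = (q-1)² Σ_{k≥1} H_m^μ(α_k)/q^{k+1}`. -/
def sOm (m : ℕ) (q : ℕ+) (μ : Measure (ℕ+ → Fin m)) : ℝ :=
  ((q : ℝ) - 1) ^ 2 * ∑' k : ℕ, Hent m μ (k + 1) / (q : ℝ) ^ (k + 2)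

/-- cylinder determined by the first `n` entries of `x`, i.e. `[x₁…x_n]`. -/
def CylN {m : ℕ} (n : ℕ) (x : ℕ+ → Fin m) : Set (ℕ+ → Fin m) :=
  {y | ∀ k : ℕ+, (k : ℕ) ≤ n → y k = x k}

/-- the cylinder `[u|J_i]` where `u = x₁…x_n`: sequences `y` with
`y_{ℓ+1} = x_{q^ℓ i}` for all `ℓ ≥ 0` with `q^ℓ i ≤ n`. -/
def CylJ {m : ℕ} (q n i : ℕ+) (x : ℕ+ → Fin m) : Set (ℕ+ → Fin m) :=
  {y | ∀ ℓ : ℕ, q ^ ℓ * i ≤ n → y ⟨ℓ + 1, Nat.succ_pos _⟩ = x (q ^ ℓ * i)}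

/-- `P` has the product structure `P[u] = ∏_{i ≤ |u|, q ∤ i} μ[u|J_i]` on cylinders. -/
def ProdProp {m : ℕ} (q : ℕ+) (μ P : Measure (ℕ+ → Fin m)) : Prop :=
  ∀ (n : ℕ+) (x : ℕ+ → Fin m),
    P (CylN (n : ℕ) x) = ∏ i ∈ (Finset.Icc 1 n).filter (fun i => ¬ q ∣ i), μ (CylJ q n i x)

/-- `t` is a `[1, m^{1/(q-1)}]`-valued solution of `t(u)^q = Σ_{j : uj ∈ Pref(Ω)} t(uj)`
on the tree of prefixes of `Ω`. -/
def TSol {m : ℕ} (q : ℕ+) (Ω : Set (ℕ+ → Fin m)) (t : List (Fin m) → ℝ) : Prop :=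
  ∀ u ∈ Pref Ω,
    t u ∈ Set.Icc 1 ((m : ℝ) ^ ((1 : ℝ) / ((q : ℝ) - 1))) ∧
    t u ^ (q : ℕ) =
      ∑ j ∈ Finset.univ.filter (fun j : Fin m => u ++ [j] ∈ Pref Ω), t (u ++ [j])

/-- `μ` has the cylinder values `μ[u₁…u_k] = ∏_{j=1}^k t(u₁…u_j)/t(u₁…u_{j-1})^q`
for prefixes `u` of `Ω`. -/
def CylVals {m : ℕ} (q : ℕ+) (Ω : Set (ℕ+ → Fin m)) (t : List (Fin m) → ℝ)
    (μ : Measure (ℕ+ → Fin m)) : Prop :=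
  ∀ u ∈ Pref Ω,
    μ (Cyl u) =
      ENNReal.ofReal (∏ j ∈ Finset.range u.length, t (u.take (j + 1)) / t (u.take j) ^ (q : ℕ))



/-! ### Prefixes -/

/-- The length-`n` prefix of `x`. -/
def pre {m : ℕ} (x : ℕ+ → Fin m) : ℕ → List (Fin m)
  | 0 => []
  | n + 1 => pre x n ++ [x n.succPNat]

theorem pre_length {m : ℕ} (x : ℕ+ → Fin m) (n : ℕ) : (pre x n).length = n := by
  induction n with
  | zero => rfl
  | succ n ih => simp [pre, ih]

theorem pre_getElem {m : ℕ} (x : ℕ+ → Fin m) (n j : ℕ) (h : j < (pre x n).length) :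
    (pre x n)[j] = x j.succPNat := by
  induction n with
  | zero => simp [pre] at h
  | succ n ih =>
    have hl := pre_length x n
    simp only [pre]
    rw [pre_length] at h
    by_cases hj : j < n
    · rw [List.getElem_append_left (by omega)]
      exact ih (by omega)
    · have : j = n := by omega
      subst this
      rw [List.getElem_append_right (by omega)]
      simp

theorem begins_iff {m : ℕ} (x : ℕ+ → Fin m) (u : List (Fin m)) :
    Begins x u ↔ pre x u.length = u := by
  constructor
  · intro h
    apply List.ext_getElem (pre_length _ _)
    intro j h1 h2
    rw [pre_getElem]
    exact h ⟨j, h2⟩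
  · intro h j
    have h1 : (j : ℕ) < (pre x u.length).length := by rw [pre_length]; exact j.2
    have := pre_getElem x u.length j h1
    simp only [List.get_eq_getElem]
    have h2 : (pre x u.length)[(j : ℕ)] = u[(j : ℕ)] := by simp [h]
    rw [← h2, this]
    rfl

theorem mem_Pref {m : ℕ} (A : Set (ℕ+ → Fin m)) (u : List (Fin m)) :
    u ∈ Pref A ↔ ∃ x ∈ A, pre x u.length = u := by
  simp only [Pref, Set.mem_ofPred_eq, begins_iff]

theorem pre_mem {m : ℕ} {A : Set (ℕ+ → Fin m)} {x : ℕ+ → Fin m} (hx : x ∈ A) (n : ℕ) :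
    pre x n ∈ Pref A := by
  rw [mem_Pref]
  exact ⟨x, hx, by rw [pre_length]⟩

theorem mem_Pref' {m : ℕ} {A : Set (ℕ+ → Fin m)} {u : List (Fin m)} (h : u ∈ Pref A) (n : ℕ)
    (hn : u.length = n) : ∃ x ∈ A, u = pre x n := by
  subst hn
  obtain ⟨x, hx, h⟩ := (mem_Pref _ _).1 h
  exact ⟨x, hx, h.symm⟩

theorem pre_congr {m : ℕ} (x y : ℕ+ → Fin m) (n : ℕ) :
    pre x n = pre y n ↔ ∀ k : ℕ, k < n → x k.succPNat = y k.succPNat := by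
  induction n with
  | zero => simp [pre]
  | succ n ih =>
    simp only [pre]
    constructor
    · intro h k hk
      obtain ⟨h1, h2⟩ := List.append_inj' h rfl
      rcases Nat.lt_succ_iff_lt_or_eq.1 hk with hk | rfl
      · exact ih.1 h1 k hk
      · simpa using h2
    · intro h
      rw [ih.2 (fun k hk => h k (by omega)), h n (by omega)]

theorem pre_congr' {m : ℕ} (x y : ℕ+ → Fin m) (n : ℕ) :
    pre x n = pre y n ↔ ∀ k : ℕ+, (k : ℕ) ≤ n → x k = y k := by
  rw [pre_congr]
  constructor
  · intro h k hk
    have := h (k.natPred) (by have := k.natPred_add_one; omega)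
    simpa using this
  · intro h k hk
    exact h _ (by simpa using hk)

/-- The words of length `n` in the prefix tree. -/
def LF {m : ℕ} (A : Set (ℕ+ → Fin m)) (n : ℕ) : Finset (List (Fin m)) :=
  ((List.finite_length_eq (Fin m) n).subset
    (fun u (hu : u.length = n ∧ u ∈ Pref A) => hu.1) :
      Set.Finite {u : List (Fin m) | u.length = n ∧ u ∈ Pref A}).toFinset

theorem mem_LF {m : ℕ} {A : Set (ℕ+ → Fin m)} {n : ℕ} {u : List (Fin m)} :
    u ∈ LF A n ↔ u.length = n ∧ u ∈ Pref A := by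
  simp [LF]

theorem NWords_eq {m : ℕ} (n : ℕ) (A : Set (ℕ+ → Fin m)) : NWords n A = (LF A n).card := by
  exact Set.ncard_eq_toFinset_card _ _

/-- The children of a word in the prefix tree. -/
def ch {m : ℕ} (A : Set (ℕ+ → Fin m)) (u : List (Fin m)) : Finset (Fin m) :=
  Finset.univ.filter (fun j => u ++ [j] ∈ Pref A)

theorem mem_ch {m : ℕ} {A : Set (ℕ+ → Fin m)} {u : List (Fin m)} {j : Fin m} :
    j ∈ ch A u ↔ u ++ [j] ∈ Pref A := by simp [ch]

theorem ncard_ch {m : ℕ} (A : Set (ℕ+ → Fin m)) (u : List (Fin m)) :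
    Set.ncard {j : Fin m | u ++ [j] ∈ Pref A} = (ch A u).card := by
  rw [← Set.ncard_coe_finset]
  congr 1
  ext j
  simp [ch]

theorem Pref_of_append {m : ℕ} {A : Set (ℕ+ → Fin m)} {u : List (Fin m)} {j : Fin m}
    (h : u ++ [j] ∈ Pref A) : u ∈ Pref A := by
  obtain ⟨x, hx, h⟩ := mem_Pref' h (u.length + 1) (by simp)
  rw [pre] at h
  rw [(List.append_inj' h rfl).1]
  exact pre_mem hx _

theorem ch_nonempty {m : ℕ} {A : Set (ℕ+ → Fin m)} {u : List (Fin m)} (h : u ∈ Pref A) :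
    (ch A u).Nonempty := by
  obtain ⟨x, hx, h⟩ := mem_Pref' h u.length rfl
  refine ⟨x u.length.succPNat, ?_⟩
  rw [mem_ch, h, pre_length]
  exact pre_mem hx (u.length + 1)

theorem sum_LF_succ {m : ℕ} (A : Set (ℕ+ → Fin m)) (n : ℕ) {R : Type*} [AddCommMonoid R]
    (f : List (Fin m) → R) :
    ∑ w ∈ LF A (n + 1), f w = ∑ u ∈ LF A n, ∑ j ∈ ch A u, f (u ++ [j]) := by
  rw [Finset.sum_sigma']
  symm
  refine Finset.sum_bij (fun p _ => p.1 ++ [p.2]) ?_ ?_ ?_ ?_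
  · rintro ⟨u, j⟩ h
    simp only [Finset.mem_sigma, mem_LF, mem_ch] at h ⊢
    exact ⟨by simp [h.1.1], h.2⟩
  · rintro ⟨u, j⟩ _ ⟨u', j'⟩ _ h
    obtain ⟨h1, h2⟩ := List.append_inj' h rfl
    simp only at h1
    simp only [List.cons.injEq, and_true] at h2
    subst h1; subst h2; rfl
  · intro w hw
    rw [mem_LF] at hw
    obtain ⟨x, hx, h⟩ := mem_Pref' hw.2 (n + 1) hw.1
    refine ⟨⟨pre x n, x n.succPNat⟩, ?_, ?_⟩
    · simp only [Finset.mem_sigma, mem_LF, mem_ch]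
      exact ⟨⟨pre_length _ _, pre_mem hx _⟩, pre_mem hx (n + 1)⟩
    · rw [h]; rfl
  · intros; rfl

theorem LF_zero {m : ℕ} {A : Set (ℕ+ → Fin m)} (h : A.Nonempty) : LF A 0 = {[]} := by
  ext u
  rw [mem_LF, Finset.mem_singleton, List.length_eq_zero_iff]
  constructor
  · exact fun h => h.1
  · rintro rfl
    obtain ⟨x, hx⟩ := h
    exact ⟨rfl, pre_mem hx 0⟩

theorem LF_nonempty {m : ℕ} {A : Set (ℕ+ → Fin m)} (h : A.Nonempty) (n : ℕ) :
    (LF A n).Nonempty := by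
  obtain ⟨x, hx⟩ := h
  exact ⟨pre x n, mem_LF.2 ⟨pre_length _ _, pre_mem hx _⟩⟩

theorem LF_card_succ {m : ℕ} (A : Set (ℕ+ → Fin m)) (n : ℕ) :
    (LF A (n + 1)).card = ∑ u ∈ LF A n, (ch A u).card := by
  have := sum_LF_succ A n (fun _ => (1 : ℕ))
  simpa using this

theorem LF_card_mono {m : ℕ} (A : Set (ℕ+ → Fin m)) (n : ℕ) :
    (LF A n).card ≤ (LF A (n + 1)).card := by
  rw [LF_card_succ, Finset.card_eq_sum_ones]
  apply Finset.sum_le_sum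
  intro u hu
  exact (ch_nonempty (mem_LF.1 hu).2).card_pos

/-! ### The decomposition `k = q ^ V k * I k` -/

theorem decomp_exists (q : ℕ+) (hq : 2 ≤ (q : ℕ)) (k : ℕ+) :
    ∃ (l : ℕ) (i : ℕ+), k = q ^ l * i ∧ ¬ q ∣ i := by
  induction k using PNat.strongInductionOn with
  | _ k ih =>
    by_cases h : q ∣ k
    · obtain ⟨k', rfl⟩ := h
      obtain ⟨l, i, h1, h2⟩ := ih k' (by
        rw [← PNat.coe_lt_coe, PNat.mul_coe]; nlinarith [k'.pos])
      exact ⟨l + 1, i, by rw [h1, pow_succ']; ring, h2⟩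
    · exact ⟨0, k, by simp, h⟩

theorem decomp_unique (q : ℕ+) {l l' : ℕ} {i i' : ℕ+} (hi : ¬ q ∣ i) (hi' : ¬ q ∣ i')
    (h : q ^ l * i = q ^ l' * i') : l = l' ∧ i = i' := by
  wlog hl : l ≤ l' generalizing l l' i i'
  · have := this hi' hi h.symm (by omega)
    exact ⟨this.1.symm, this.2.symm⟩
  obtain ⟨d, rfl⟩ := Nat.exists_eq_add_of_le hl
  rw [pow_add, mul_assoc] at h
  have h2 := mul_left_cancel h
  cases d with
  | zero => simpa using h2
  | succ d =>
    exfalso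
    apply hi
    rw [h2, pow_succ', mul_assoc]
    exact dvd_mul_right _ _

/-- exponent part -/
def VV (q : ℕ+) (k : ℕ+) : ℕ :=
  if h : 2 ≤ (q : ℕ) then (decomp_exists q h k).choose else 0

/-- coprime part -/
def II (q : ℕ+) (k : ℕ+) : ℕ+ :=
  if h : 2 ≤ (q : ℕ) then (decomp_exists q h k).choose_spec.choose else 1

theorem VI_spec {q : ℕ+} (hq : 2 ≤ (q : ℕ)) (k : ℕ+) :
    q ^ (VV q k) * II q k = k ∧ ¬ q ∣ II q k := by
  have := (decomp_exists q hq k).choose_spec.choose_spec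
  simp only [VV, II, dif_pos hq]
  exact ⟨this.1.symm, this.2⟩

theorem VI_eq {q : ℕ+} (hq : 2 ≤ (q : ℕ)) (l : ℕ) (i : ℕ+) (hi : ¬ q ∣ i) :
    VV q (q ^ l * i) = l ∧ II q (q ^ l * i) = i := by
  have := VI_spec hq (q ^ l * i)
  exact decomp_unique q this.2 hi this.1

theorem VI_mul {q : ℕ+} (hq : 2 ≤ (q : ℕ)) (k : ℕ+) :
    VV q (q * k) = VV q k + 1 ∧ II q (q * k) = II q k := by
  have h := VI_spec hq k
  have := VI_eq hq (VV q k + 1) (II q k) h.2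
  rw [pow_succ', mul_assoc, h.1] at this
  exact this

theorem VV_ndvd {q : ℕ+} (hq : 2 ≤ (q : ℕ)) (k : ℕ+) (hk : ¬ q ∣ k) :
    VV q k = 0 ∧ II q k = k := by
  have := VI_eq hq 0 k hk
  simpa using this

/-- word along the progression through `k`, strictly before `k` -/
def JM {m : ℕ} (q : ℕ+) (x : ℕ+ → Fin m) (k : ℕ+) : List (Fin m) :=
  pre (RestrJ q x (II q k)) (VV q k)

/-- word along the progression through `k`, up to and including `k` -/
def JP {m : ℕ} (q : ℕ+) (x : ℕ+ → Fin m) (k : ℕ+) : List (Fin m) :=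
  pre (RestrJ q x (II q k)) (VV q k + 1)

theorem JP_eq {m : ℕ} {q : ℕ+} (hq : 2 ≤ (q : ℕ)) (x : ℕ+ → Fin m) (k : ℕ+) :
    JP q x k = JM q x k ++ [x k] := by
  simp only [JP, JM, pre, RestrJ]
  simp [(VI_spec hq k).1]

theorem JM_mul {m : ℕ} {q : ℕ+} (hq : 2 ≤ (q : ℕ)) (x : ℕ+ → Fin m) (k : ℕ+) :
    JM q x (q * k) = JP q x k := by
  simp only [JP, JM, (VI_mul hq k).1, (VI_mul hq k).2]

theorem JM_ndvd {m : ℕ} {q : ℕ+} (hq : 2 ≤ (q : ℕ)) (x : ℕ+ → Fin m) (k : ℕ+) (hk : ¬ q ∣ k) :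
    JM q x k = [] := by
  simp only [JM, (VV_ndvd hq k hk).1, pre]

theorem JM_mem {m : ℕ} {q : ℕ+} (hq : 2 ≤ (q : ℕ)) {Ω : Set (ℕ+ → Fin m)} {x : ℕ+ → Fin m}
    (hx : x ∈ XOm q Ω) (k : ℕ+) : JM q x k ∈ Pref Ω :=
  pre_mem (hx _ (VI_spec hq k).2) _

theorem JP_mem {m : ℕ} {q : ℕ+} (hq : 2 ≤ (q : ℕ)) {Ω : Set (ℕ+ → Fin m)} {x : ℕ+ → Fin m}
    (hx : x ∈ XOm q Ω) (k : ℕ+) : JP q x k ∈ Pref Ω :=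
  pre_mem (hx _ (VI_spec hq k).2) _

theorem JM_congr {m : ℕ} {q : ℕ+} (hq : 2 ≤ (q : ℕ)) {x y : ℕ+ → Fin m} {k : ℕ+}
    (h : ∀ j : ℕ+, j < k → x j = y j) : JM q x k = JM q y k := by
  rw [JM, JM, pre_congr]
  intro l hl
  simp only [RestrJ]
  apply h
  conv_rhs => rw [← (VI_spec hq k).1]
  rw [← PNat.coe_lt_coe]
  simp only [Nat.succPNat_coe, Nat.succ_eq_add_one, Nat.add_sub_cancel, PNat.mul_coe, PNat.pow_coe]
  exact Nat.mul_lt_mul_of_pos_right (Nat.pow_lt_pow_right (by omega) hl) (PNat.pos _)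

/-- gluing -/
def glue {m : ℕ} (q : ℕ+) (y : ℕ+ → ℕ+ → Fin m) : ℕ+ → Fin m :=
  fun k => y (II q k) (VV q k).succPNat

theorem RestrJ_glue {m : ℕ} {q : ℕ+} (hq : 2 ≤ (q : ℕ)) (y : ℕ+ → ℕ+ → Fin m) (i : ℕ+)
    (hi : ¬ q ∣ i) : RestrJ q (glue q y) i = y i := by
  funext k
  simp only [RestrJ, glue, (VI_eq hq _ i hi).1, (VI_eq hq _ i hi).2]
  congr 1
  apply PNat.eq
  have := k.pos
  simp only [Nat.succPNat_coe]
  omega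

theorem glue_mem {m : ℕ} {q : ℕ+} (hq : 2 ≤ (q : ℕ)) {Ω : Set (ℕ+ → Fin m)}
    {y : ℕ+ → ℕ+ → Fin m} (hy : ∀ i, y i ∈ Ω) : glue q y ∈ XOm q Ω := by
  intro i hi
  rw [RestrJ_glue hq y i hi]
  exact hy i

theorem XOm_nonempty {m : ℕ} {q : ℕ+} (hq : 2 ≤ (q : ℕ)) {Ω : Set (ℕ+ → Fin m)}
    (h : Ω.Nonempty) : (XOm q Ω).Nonempty := by
  obtain ⟨y, hy⟩ := h
  exact ⟨_, glue_mem (y := fun _ => y) hq (fun _ => hy)⟩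


/-! ### The solution `t` -/

theorem exists_TSol {m : ℕ} (hm : 2 ≤ m) {q : ℕ+} (hq : 2 ≤ (q : ℕ)) (Ω : Set (ℕ+ → Fin m)) :
    ∃ t, TSol q Ω t := by
  set M : ℝ := (m : ℝ) ^ ((1 : ℝ) / ((q : ℝ) - 1)) with hMdef
  have hq' : (2 : ℝ) ≤ (q : ℕ) := by exact_mod_cast hq
  have hm' : (2 : ℝ) ≤ m := by exact_mod_cast hm
  have hM1 : 1 ≤ M := Real.one_le_rpow (by linarith) (by
    apply div_nonneg <;> linarith)
  have hM0 : 0 ≤ M := by linarith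
  have hMq : (m * M : ℝ) ^ ((1 : ℝ) / (q : ℕ)) = M := by
    have h1 : (m : ℝ) = M ^ (((q : ℕ) : ℝ) - 1) := by
      rw [hMdef, ← Real.rpow_mul (by linarith), one_div, inv_mul_cancel₀ (by linarith),
        Real.rpow_one]
    conv_lhs => rw [h1]
    have h2 : M ^ (((q : ℕ) : ℝ) - 1) * M = M ^ (((q : ℕ) : ℝ)) := by
      rw [← Real.rpow_add_one (by linarith)]; congr 1; ring
    rw [h2, ← Real.rpow_mul hM0, mul_one_div_cancel (by linarith), Real.rpow_one]
  have : Fact (1 ≤ M) := ⟨hM1⟩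
  let _ : CompleteLattice (Set.Icc (1 : ℝ) M) := Set.Icc.completeLattice
  let F : (List (Fin m) → Set.Icc (1 : ℝ) M) →o (List (Fin m) → Set.Icc (1 : ℝ) M) :=
    { toFun := fun t u => Set.projIcc 1 M hM1
        ((∑ j ∈ ch Ω u, (t (u ++ [j]) : ℝ)) ^ ((1 : ℝ) / (q : ℕ)))
      monotone' := by
        intro t t' h u
        apply Set.monotone_projIcc
        apply Real.rpow_le_rpow
        · exact Finset.sum_nonneg (fun j _ => le_trans zero_le_one (t _).2.1)
        · exact Finset.sum_le_sum (fun j _ => h _)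
        · positivity }
  let t := OrderHom.lfp F
  have ht : F t = t := OrderHom.map_lfp F
  refine ⟨fun u => t u, fun u hu => ⟨(t u).2, ?_⟩⟩
  have h1 : (1 : ℝ) ≤ ∑ j ∈ ch Ω u, (t (u ++ [j]) : ℝ) := by
    obtain ⟨j, hj⟩ := ch_nonempty hu
    calc (1 : ℝ) ≤ t (u ++ [j]) := (t _).2.1
      _ ≤ _ := Finset.single_le_sum (f := fun j => (t (u ++ [j]) : ℝ))
        (fun j _ => le_trans zero_le_one (t _).2.1) hj
  have h2 : ∑ j ∈ ch Ω u, (t (u ++ [j]) : ℝ) ≤ m * M := by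
    calc _ ≤ ∑ j ∈ ch Ω u, M := Finset.sum_le_sum (fun j _ => (t _).2.2)
      _ = (ch Ω u).card * M := by simp
      _ ≤ m * M := by
        gcongr
        exact (Finset.card_le_univ _).trans (by simp)
  have h3 : (t u : ℝ) = (∑ j ∈ ch Ω u, (t (u ++ [j]) : ℝ)) ^ ((1 : ℝ) / (q : ℕ)) := by
    conv_lhs => rw [← ht]
    show ((Set.projIcc 1 M hM1 _ : Set.Icc (1 : ℝ) M) : ℝ) = _
    rw [Set.projIcc_of_mem hM1 ⟨Real.one_le_rpow h1 (by positivity), ?_⟩]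
    exact le_trans (Real.rpow_le_rpow (by linarith) h2 (by positivity)) hMq.le
  show (t u : ℝ) ^ (q : ℕ) = ∑ j ∈ ch Ω u, (t (u ++ [j]) : ℝ)
  rw [h3, ← Real.rpow_natCast, ← Real.rpow_mul (by linarith), one_div_mul_cancel (by linarith),
    Real.rpow_one]

/-! ### Jensen -/

/-- log of the average of `t` on level `k` -/
def dl {m : ℕ} (Ω : Set (ℕ+ → Fin m)) (t : List (Fin m) → ℝ) (k : ℕ) : ℝ :=
  Real.log ((∑ u ∈ LF Ω k, t u) / (LF Ω k).card)

/-- log of the number of words of length `k` -/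
def HH {m : ℕ} (Ω : Set (ℕ+ → Fin m)) (k : ℕ) : ℝ := Real.log ((LF Ω k).card)

theorem LFc_pos {m : ℕ} {Ω : Set (ℕ+ → Fin m)} (h : Ω.Nonempty) (n : ℕ) :
    (0 : ℝ) < (LF Ω n).card := by exact_mod_cast (LF_nonempty h n).card_pos

theorem tsum_pos {m : ℕ} {q : ℕ+} {Ω : Set (ℕ+ → Fin m)} (hne : Ω.Nonempty)
    {t : List (Fin m) → ℝ} (ht : TSol q Ω t) (k : ℕ) : 0 < ∑ u ∈ LF Ω k, t u :=
  Finset.sum_pos (fun u hu => lt_of_lt_of_le one_pos (ht u (mem_LF.1 hu).2).1.1)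
    (LF_nonempty hne k)

theorem sum_pow_eq {m : ℕ} {q : ℕ+} {Ω : Set (ℕ+ → Fin m)}
    {t : List (Fin m) → ℝ} (ht : TSol q Ω t) (k : ℕ) :
    ∑ u ∈ LF Ω k, t u ^ (q : ℕ) = ∑ u ∈ LF Ω (k + 1), t u := by
  rw [sum_LF_succ]
  exact Finset.sum_congr rfl (fun u hu => (ht u (mem_LF.1 hu).2).2)

theorem jensen_log {m : ℕ} {q : ℕ+} {Ω : Set (ℕ+ → Fin m)} (hne : Ω.Nonempty)
    {t : List (Fin m) → ℝ} (ht : TSol q Ω t) (k : ℕ) :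
    dl Ω t (k + 1) + HH Ω (k + 1) - HH Ω k =
      Real.log (∑ u ∈ LF Ω k, (1 / ((LF Ω k).card : ℝ)) • t u ^ (q : ℕ)) := by
  have h1 := LFc_pos hne k
  have h2 := LFc_pos hne (k + 1)
  have h3 := tsum_pos hne ht (k + 1)
  rw [← Finset.smul_sum, sum_pow_eq ht, smul_eq_mul, dl, HH, HH, Real.log_div h3.ne' h2.ne',
    Real.log_mul (by positivity) h3.ne', one_div, Real.log_inv]
  ring

theorem jensen_log' {m : ℕ} {q : ℕ+} {Ω : Set (ℕ+ → Fin m)} 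
    {t : List (Fin m) → ℝ} (k : ℕ) :
    (q : ℕ) * dl Ω t k =
      Real.log ((∑ u ∈ LF Ω k, (1 / ((LF Ω k).card : ℝ)) • t u) ^ (q : ℕ)) := by
  rw [Real.log_pow, dl, ← Finset.smul_sum, smul_eq_mul]
  congr 2
  ring

theorem wsum {m : ℕ} {Ω : Set (ℕ+ → Fin m)} (hne : Ω.Nonempty) (k : ℕ) :
    ∑ _u ∈ LF Ω k, (1 / ((LF Ω k).card : ℝ)) = 1 := by
  have := LFc_pos hne k
  simp; field_simp

theorem avg_pow_pos {m : ℕ} {q : ℕ+} {Ω : Set (ℕ+ → Fin m)} (hne : Ω.Nonempty)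
    {t : List (Fin m) → ℝ} (ht : TSol q Ω t) (k : ℕ) :
    0 < (∑ u ∈ LF Ω k, (1 / ((LF Ω k).card : ℝ)) • t u) ^ (q : ℕ) := by
  rw [← Finset.smul_sum, smul_eq_mul]
  have := LFc_pos hne k
  have := tsum_pos hne ht k
  positivity

theorem dl_le {m : ℕ} {q : ℕ+} {Ω : Set (ℕ+ → Fin m)} (hne : Ω.Nonempty)
    {t : List (Fin m) → ℝ} (ht : TSol q Ω t) (k : ℕ) :
    (q : ℕ) * dl Ω t k ≤ dl Ω t (k + 1) + HH Ω (k + 1) - HH Ω k := by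
  rw [jensen_log hne ht, jensen_log']
  apply Real.log_le_log (avg_pow_pos hne ht k)
  exact (convexOn_pow (q : ℕ)).map_sum_le (fun _ _ => by positivity) (wsum hne k)
    (fun u hu => le_trans zero_le_one (ht u (mem_LF.1 hu).2).1.1)

theorem dl_lt {m : ℕ} {q : ℕ+} (hq : 2 ≤ (q : ℕ)) {Ω : Set (ℕ+ → Fin m)} (hne : Ω.Nonempty)
    {t : List (Fin m) → ℝ} (ht : TSol q Ω t) (k : ℕ)
    (hk : ∃ u ∈ LF Ω k, ∃ v ∈ LF Ω k, t u ≠ t v) :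
    (q : ℕ) * dl Ω t k < dl Ω t (k + 1) + HH Ω (k + 1) - HH Ω k := by
  rw [jensen_log hne ht, jensen_log']
  apply Real.log_lt_log (avg_pow_pos hne ht k)
  have := LFc_pos hne k
  exact (strictConvexOn_pow hq).map_sum_lt (fun _ _ => by positivity) (wsum hne k)
    (fun u hu => le_trans zero_le_one (ht u (mem_LF.1 hu).2).1.1) hk

/-- If `t` is constant on levels the tree is spherically symmetric. -/
theorem sym_of_const {m : ℕ} {q : ℕ+} {Ω : Set (ℕ+ → Fin m)}
    {t : List (Fin m) → ℝ} (ht : TSol q Ω t)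
    (hk : ∀ k, ∀ u ∈ LF Ω k, ∀ v ∈ LF Ω k, t u = t v) (k : ℕ) :
    ∀ u ∈ LF Ω k, ∀ v ∈ LF Ω k, (ch Ω u).card = (ch Ω v).card := by
  have key : ∀ u ∈ LF Ω k, ∀ w ∈ LF Ω (k + 1), t u ^ (q : ℕ) = (ch Ω u).card * t w := by
    intro u hu w hw
    rw [(ht u (mem_LF.1 hu).2).2]
    show ∑ j ∈ ch Ω u, _ = _
    rw [Finset.sum_congr rfl (g := fun _ => t w)]
    · simp
    · intro j hj
      apply hk (k + 1) _ _ _ hw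
      exact mem_LF.2 ⟨by simp [(mem_LF.1 hu).1], mem_ch.1 hj⟩
  intro u hu v hv
  obtain ⟨j, hj⟩ := ch_nonempty (mem_LF.1 hu).2
  have hw : u ++ [j] ∈ LF Ω (k + 1) :=
    mem_LF.2 ⟨by simp [(mem_LF.1 hu).1], mem_ch.1 hj⟩
  have h1 := key u hu _ hw
  have h2 := key v hv _ hw
  rw [hk k u hu v hv, h2] at h1
  have h3 : t (u ++ [j]) ≠ 0 := by
    have := (ht _ (mem_LF.1 hw).2).1.1
    linarith
  exact_mod_cast (mul_right_cancel₀ h3 h1).symm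

theorem dl_bounds {m : ℕ} {q : ℕ+} {Ω : Set (ℕ+ → Fin m)} (hne : Ω.Nonempty)
    {t : List (Fin m) → ℝ} (ht : TSol q Ω t) (k : ℕ) :
    dl Ω t k ≤ Real.log ((m : ℝ) ^ ((1 : ℝ) / ((q : ℝ) - 1))) := by
  have h1 := LFc_pos hne k
  have h2 := tsum_pos hne ht k
  apply Real.log_le_log (by positivity)
  rw [div_le_iff₀ h1]
  calc ∑ u ∈ LF Ω k, t u ≤ ∑ _u ∈ LF Ω k, ((m : ℝ) ^ ((1 : ℝ) / ((q : ℝ) - 1))) :=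
        Finset.sum_le_sum (fun u hu => (ht u (mem_LF.1 hu).2).1.2)
    _ = _ := by rw [Finset.sum_const, nsmul_eq_mul, mul_comm]

/-- telescoped bound with a slack `η` at level `k0` -/
theorem dl_chain {m : ℕ} {q : ℕ+} {Ω : Set (ℕ+ → Fin m)} (hne : Ω.Nonempty)
    {t : List (Fin m) → ℝ} (ht : TSol q Ω t) (k0 : ℕ) (η : ℝ)
    (hη : (q : ℕ) * dl Ω t k0 + η ≤ dl Ω t (k0 + 1) + HH Ω (k0 + 1) - HH Ω k0) (K : ℕ) :
    dl Ω t 0 + (if k0 < K then η / (q : ℝ) ^ (k0 + 1) else 0) ≤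
      ∑ j ∈ Finset.range K, (HH Ω (j + 1) - HH Ω j) / (q : ℝ) ^ (j + 1) +
        dl Ω t K / (q : ℝ) ^ K := by
  have hq0 : (0 : ℝ) < (q : ℕ) := by exact_mod_cast q.pos
  induction K with
  | zero => simp
  | succ K ih =>
    rw [Finset.sum_range_succ]
    have e : (if k0 < K + 1 then η / (q : ℝ) ^ (k0 + 1) else 0) =
      (if k0 < K then η / (q : ℝ) ^ (k0 + 1) else 0) +
        (if k0 = K then η else 0) / (q : ℝ) ^ (K + 1) := by
      rcases lt_trichotomy k0 K with h | h | h
      · rw [if_pos (by omega), if_pos h, if_neg (by omega)]; simp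
      · subst h; simp
      · rw [if_neg (by omega), if_neg (by omega), if_neg (by omega)]; simp
    rw [e]
    have h1 : (q : ℕ) * dl Ω t K + (if k0 = K then η else 0) ≤
        dl Ω t (K + 1) + HH Ω (K + 1) - HH Ω K := by
      split_ifs with h
      · subst h; exact hη
      · simpa using dl_le hne ht K
    have h2 : dl Ω t K / (q : ℝ) ^ K + (if k0 = K then η else 0) / (q : ℝ) ^ (K + 1) ≤
        (HH Ω (K + 1) - HH Ω K) / (q : ℝ) ^ (K + 1) + dl Ω t (K + 1) / (q : ℝ) ^ (K + 1) := by
      have : dl Ω t K / (q : ℝ) ^ K = ((q : ℕ) * dl Ω t K) / (q : ℝ) ^ (K + 1) := by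
        rw [pow_succ']; field_simp
      rw [this, ← add_div, ← add_div]
      apply div_le_div_of_nonneg_right _ (by positivity)
      linarith
    linarith


/-! ### Counting -/

theorem block_sum (q : ℕ+) (F f : ℕ+ → ℝ) (g : ℝ) (h1 : ∀ k, F (q * k) = f k)
    (h2 : ∀ k, ¬ q ∣ k → F k = g) (n : ℕ) :
    ∑ k ∈ Finset.range (q * n), F k.succPNat =
      ∑ k ∈ Finset.range n, f k.succPNat + ((q : ℝ) - 1) * n * g := by
  induction n with
  | zero => simp
  | succ n ih =>
    obtain ⟨q', hq'⟩ : ∃ q', (q : ℕ) = q' + 1 := ⟨q - 1, by have := q.pos; omega⟩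
    have e : (q : ℕ) * (n + 1) = q * n + (q' + 1) := by rw [← hq']; ring
    rw [e, Finset.sum_range_add, ih, Finset.sum_range_succ, Finset.sum_range_succ]
    have h3 : F ((q : ℕ) * n + q').succPNat = f n.succPNat := by
      rw [← h1]
      congr 1
      apply PNat.eq
      simp only [Nat.succPNat_coe, PNat.mul_coe, Nat.succ_eq_add_one]
      rw [mul_add, mul_one, hq']; ring
    have h4 : ∑ r ∈ Finset.range q', F ((q : ℕ) * n + r).succPNat = q' * g := by
      rw [Finset.sum_congr rfl (g := fun _ => g)]
      · simp
      · intro r hr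
        apply h2
        rw [PNat.dvd_iff]
        simp only [Nat.succPNat_coe, Nat.succ_eq_add_one, add_assoc]
        rw [Nat.dvd_add_right (dvd_mul_right _ _)]
        intro h
        have := Nat.le_of_dvd (by omega) h
        have := Finset.mem_range.1 hr
        omega
    rw [h3, h4]
    have : ((q : ℕ) : ℝ) = q' + 1 := by rw [hq']; push_cast; ring
    rw [this]
    push_cast
    ring

/-- number of `l` with `q^l * i ≤ n` -/
def ell (q i n : ℕ) : ℕ := Nat.log q (q * n / i)

theorem lt_ell {q i n : ℕ} (hq : 2 ≤ q) (hi : 0 < i) (l : ℕ) :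
    l < ell q i n ↔ q ^ l * i ≤ n := by
  rw [ell]
  by_cases h0 : q * n / i = 0
  · rw [h0]
    simp only [Nat.log_zero_right, not_lt_zero, false_iff, not_le]
    rw [Nat.div_eq_zero_iff] at h0
    have h1 : q * n < i := by omega
    have h2 : 1 ≤ q ^ l := Nat.one_le_pow _ _ (by omega)
    nlinarith
  · rw [← Nat.add_one_le_iff, Nat.le_log_iff_pow_le (by omega) h0, Nat.le_div_iff_mul_le hi,
      pow_succ', mul_assoc]
    exact ⟨fun h => Nat.le_of_mul_le_mul_left h (by omega), fun h => Nat.mul_le_mul_left _ h⟩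

theorem ell_mul {q i n : ℕ} (hq : 2 ≤ q) (hi : 0 < i) (hin : i ≤ q * n) :
    ell q i (q * n) = ell q i n + 1 := by
  apply eq_of_forall_lt_iff
  intro l
  cases l with
  | zero => rw [lt_ell hq hi]; simpa using hin
  | succ l =>
    rw [lt_ell hq hi, Nat.add_lt_add_iff_right, lt_ell hq hi, pow_succ', mul_assoc]
    exact ⟨fun h => Nat.le_of_mul_le_mul_left h (by omega), fun h => Nat.mul_le_mul_left _ h⟩

theorem ell_zero {q i n : ℕ} (hq : 2 ≤ q) (hi : n < i) : ell q i n = 0 := by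
  by_contra h
  have := (lt_ell (n := n) hq (by omega : 0 < i) 0).1 (by omega)
  simp at this
  omega

/-- the sum over progressions -/
def RR (q : ℕ+) (H : ℕ → ℝ) (n : ℕ) : ℝ :=
  ∑ i ∈ Finset.range n, if q ∣ i.succPNat then 0 else H (ell q (i + 1) n)

theorem RR_mul {q : ℕ+} (hq : 2 ≤ (q : ℕ)) (H : ℕ → ℝ) (n : ℕ) :
    RR q H (q * n) = ((q : ℝ) - 1) * n * H 1 + RR q (fun l => H (l + 1) - H 1) n := by
  have hb := block_sum q (fun k => if q ∣ k then 0 else H 1) (fun _ => 0) (H 1)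
    (fun k => by simp) (fun k hk => by simp [hk]) n
  simp only [Finset.sum_const_zero, zero_add] at hb
  rw [← hb]
  have : RR q (fun l => H (l + 1) - H 1) n =
      ∑ i ∈ Finset.range (q * n), if q ∣ i.succPNat then 0 else
        (H (ell q (i + 1) n + 1) - H 1) := by
    rw [RR]
    apply Finset.sum_subset
    · intro i hi
      rw [Finset.mem_range] at *
      nlinarith
    · intro i hi hi'
      rw [Finset.mem_range] at *
      rw [ell_zero hq (by omega)]
      simp
  rw [this, RR, ← Finset.sum_add_distrib]
  apply Finset.sum_congr rfl
  intro i hi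
  rw [Finset.mem_range] at hi
  rw [ell_mul hq (by omega) (by omega)]
  split_ifs <;> ring

theorem RR_pow {q : ℕ+} (hq : 2 ≤ (q : ℕ)) (K : ℕ) : ∀ H : ℕ → ℝ, H 0 = 0 →
    RR q H ((q : ℕ) ^ K) / (q : ℝ) ^ K =
      ((q : ℝ) - 1) * ∑ j ∈ Finset.range K, (H (j + 1) - H j) / (q : ℝ) ^ (j + 1) +
        (H (K + 1) - H K) / (q : ℝ) ^ K := by
  have hq0 : ((q : ℕ) : ℝ) ≠ 0 := by exact_mod_cast q.pos.ne'
  induction K with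
  | zero =>
    intro H hH
    have h1 : ¬ q ∣ (1 : ℕ+) := by
      rw [PNat.dvd_iff]; intro h; have := Nat.le_of_dvd (by simp) h; simp at this; omega
    have h2 : ell q 1 1 = 1 := by
      apply eq_of_forall_lt_iff
      intro l
      rw [lt_ell hq one_pos]
      constructor
      · intro h
        by_contra hl
        have := Nat.one_lt_pow (n := l) (by omega) (by omega : 1 < (q : ℕ))
        omega
      · intro h
        have : l = 0 := by omega
        subst this; simp
    have h3 : (0 : ℕ).succPNat = 1 := rfl
    simp [RR, h1, h2, hH, h3]
  | succ K ih =>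
    intro H hH
    have e : (q : ℕ) ^ (K + 1) = q * (q : ℕ) ^ K := pow_succ' _ _
    rw [e, RR_mul hq, add_div]
    have h1 := ih (fun l => H (l + 1) - H 1) (by simp)
    have h2 : RR q (fun l => H (l + 1) - H 1) ((q : ℕ) ^ K) / (q : ℝ) ^ (K + 1) =
      (RR q (fun l => H (l + 1) - H 1) ((q : ℕ) ^ K) / (q : ℝ) ^ K) / q := by
      rw [pow_succ]; field_simp
    rw [h2, h1, Finset.sum_range_succ', hH]
    push_cast
    have h3 : ∑ k ∈ Finset.range K, (H (k + 1 + 1) - H (k + 1)) / (q : ℝ) ^ (k + 1 + 1) =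
      (∑ k ∈ Finset.range K, (H (k + 1 + 1) - H 1 - (H (k + 1) - H 1)) / (q : ℝ) ^ (k + 1)) / q := by
      rw [Finset.sum_div]
      apply Finset.sum_congr rfl
      intro k _
      rw [pow_succ _ (k + 1)]
      field_simp
      ring
    rw [h3]
    field_simp
    ring

/-- extend a list to a sequence -/
def ext {m : ℕ} (hm : 0 < m) (w : List (Fin m)) : ℕ+ → Fin m :=
  fun k => w.getD (k - 1) ⟨0, hm⟩

theorem ext_pre {m : ℕ} (hm : 0 < m) (x : ℕ+ → Fin m) (n : ℕ) (k : ℕ+) (hk : (k : ℕ) ≤ n) :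
    ext hm (pre x n) k = x k := by
  have h1 : (k : ℕ) - 1 < (pre x n).length := by
    rw [pre_length]; have := k.pos; omega
  rw [ext, List.getD_eq_getElem _ _ h1, pre_getElem]
  congr 1
  apply PNat.eq
  have := k.pos
  simp only [Nat.succPNat_coe]
  omega

theorem card_X_ge {m : ℕ} (hm : 0 < m) {q : ℕ+} (hq : 2 ≤ (q : ℕ)) {Ω : Set (ℕ+ → Fin m)}
    (hne : Ω.Nonempty) (n : ℕ) :
    ∏ i ∈ (Finset.range n).filter (fun i => ¬ q ∣ i.succPNat), (LF Ω (ell q (i + 1) n)).card ≤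
      (LF (XOm q Ω) n).card := by
  rw [← Finset.card_pi]
  apply Finset.card_le_card_of_surjOn
    (fun w i _ => pre (RestrJ q (ext hm w) i.succPNat) (ell q (i + 1) n))
  intro u hu
  rw [Finset.mem_coe, Finset.mem_pi] at hu
  have : ∀ i : ℕ+, ∃ y ∈ Ω, ∀ h : i.natPred ∈
      (Finset.range n).filter (fun i => ¬ q ∣ i.succPNat),
      u i.natPred h = pre y (ell q i n) := by
    intro i
    by_cases h : i.natPred ∈ (Finset.range n).filter (fun i => ¬ q ∣ i.succPNat)
    · have h1 := mem_LF.1 (hu _ h)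
      obtain ⟨y, hy, h2⟩ := mem_Pref' h1.2 _ h1.1
      refine ⟨y, hy, fun _ => ?_⟩
      rw [h2, PNat.natPred_add_one]
    · obtain ⟨y, hy⟩ := hne
      exact ⟨y, hy, fun h' => absurd h' h⟩
  choose y hy hy' using this
  have hg := glue_mem (q := q) hq hy
  refine ⟨pre (glue q y) n, mem_LF.2 ⟨pre_length _ _, pre_mem hg _⟩, ?_⟩
  funext i hi
  have hi' := Finset.mem_filter.1 hi
  have h1 := hy' i.succPNat (by simpa using hi)
  simp only [Nat.natPred_succPNat, Nat.succPNat_coe, Nat.succ_eq_add_one] at h1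
  rw [h1, ← RestrJ_glue hq y _ hi'.2, pre_congr]
  intro l hl
  rw [lt_ell hq (by omega)] at hl
  simp only [RestrJ]
  apply ext_pre
  simpa using hl

theorem RR_le {m : ℕ} (hm : 0 < m) {q : ℕ+} (hq : 2 ≤ (q : ℕ)) {Ω : Set (ℕ+ → Fin m)}
    (hne : Ω.Nonempty) (n : ℕ) : RR q (HH Ω) n ≤ HH (XOm q Ω) n := by
  have h := card_X_ge hm hq hne n
  have h' : (∏ i ∈ (Finset.range n).filter (fun i => ¬ q ∣ i.succPNat),
      ((LF Ω (ell q (i + 1) n)).card : ℝ)) ≤ (LF (XOm q Ω) n).card := by exact_mod_cast h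
  have h2 := Real.log_le_log (Finset.prod_pos (fun i _ => LFc_pos hne _)) h'
  rw [Real.log_prod (fun i _ => (LFc_pos hne _).ne')] at h2
  refine le_trans (le_of_eq ?_) h2
  rw [RR, Finset.sum_filter]
  apply Finset.sum_congr rfl
  intro i _
  rw [ite_not]
  rfl

theorem d_ge {m : ℕ} (hm : 2 ≤ m) {q : ℕ+} (hq : 2 ≤ (q : ℕ))
    {Ω : Set (ℕ+ → Fin m)} (hne : Ω.Nonempty) {d : ℝ}
    (hlim : Tendsto (fun n : ℕ => Real.logb m (NWords n (XOm q Ω)) / n) atTop (𝓝 d))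
    {t : List (Fin m) → ℝ} (ht : TSol q Ω t) (k0 : ℕ) (η : ℝ)
    (hη : (q : ℕ) * dl Ω t k0 + η ≤ dl Ω t (k0 + 1) + HH Ω (k0 + 1) - HH Ω k0) :
    ((q : ℝ) - 1) * (dl Ω t 0 + η / (q : ℝ) ^ (k0 + 1)) ≤ d * Real.log m := by
  have hq' : (2 : ℝ) ≤ (q : ℕ) := by exact_mod_cast hq
  have hm' : (2 : ℝ) ≤ m := by exact_mod_cast hm
  have hlogm : 0 < Real.log m := Real.log_pos (by linarith)
  set L := Real.log ((m : ℝ) ^ ((1 : ℝ) / ((q : ℝ) - 1))) with hL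
  have hpow : Tendsto (fun K : ℕ => (q : ℕ) ^ K) atTop atTop :=
    tendsto_pow_atTop_atTop_of_one_lt (by omega)
  have h1 : Tendsto (fun K : ℕ => HH (XOm q Ω) ((q : ℕ) ^ K) / (q : ℝ) ^ K) atTop
      (𝓝 (d * Real.log m)) := by
    have := (hlim.comp hpow).mul_const (Real.log m)
    refine this.congr (fun K => ?_)
    simp only [Function.comp, NWords_eq, HH, Real.logb, Nat.cast_pow]
    field_simp
  have h2 : Tendsto (fun K : ℕ => ((q : ℝ) - 1) *
      (dl Ω t 0 + η / (q : ℝ) ^ (k0 + 1) - L * ((q : ℝ)⁻¹) ^ K)) atTop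
      (𝓝 (((q : ℝ) - 1) * (dl Ω t 0 + η / (q : ℝ) ^ (k0 + 1) - L * 0))) := by
    apply Tendsto.const_mul
    apply Tendsto.const_sub
    apply Tendsto.const_mul
    apply tendsto_pow_atTop_nhds_zero_of_lt_one (by positivity)
    exact inv_lt_one_of_one_lt₀ (by linarith)
  rw [mul_zero, sub_zero] at h2
  refine le_of_tendsto_of_tendsto h2 h1 ?_
  filter_upwards [eventually_gt_atTop k0] with K hK
  have h3 := RR_le (by omega) hq hne ((q : ℕ) ^ K)
  have hqK : (0 : ℝ) < (q : ℝ) ^ K := by positivity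
  have h4 := RR_pow hq K (HH Ω) (by simp [HH, LF_zero hne])
  have h5 := dl_chain hne ht k0 η hη K
  rw [if_pos hK] at h5
  have h6 : HH Ω K ≤ HH Ω (K + 1) :=
    Real.log_le_log (LFc_pos hne K) (by exact_mod_cast LF_card_mono Ω K)
  have h7 : dl Ω t K / (q : ℝ) ^ K ≤ L * ((q : ℝ)⁻¹) ^ K := by
    rw [inv_pow, ← div_eq_mul_inv]
    exact div_le_div_of_nonneg_right (dl_bounds hne ht K) hqK.le
  have h8 : 0 ≤ (HH Ω (K + 1) - HH Ω K) / (q : ℝ) ^ K := div_nonneg (by linarith) hqK.le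
  have h9 := div_le_div_of_nonneg_right h3 hqK.le
  rw [h4] at h9
  refine le_trans ?_ h9
  have : ((q : ℝ) - 1) *
      (dl Ω t 0 + η / (q : ℝ) ^ (k0 + 1) - L * ((q : ℝ)⁻¹) ^ K) ≤
      ((q : ℝ) - 1) * ∑ j ∈ Finset.range K, (HH Ω (j + 1) - HH Ω j) / (q : ℝ) ^ (j + 1) := by
    apply mul_le_mul_of_nonneg_left _ (by linarith)
    linarith
  linarith

theorem dl_zero {m : ℕ} {Ω : Set (ℕ+ → Fin m)} (hne : Ω.Nonempty) (t : List (Fin m) → ℝ) :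
    dl Ω t 0 = Real.log (t []) := by
  simp [dl, LF_zero hne]


/-! ### Digits -/

/-- integer formed by the first `n` digits -/
def AA {m : ℕ} (x : ℕ+ → Fin m) : ℕ → ℕ
  | 0 => 0
  | n + 1 => m * AA x n + x n.succPNat

theorem AA_congr {m : ℕ} {x y : ℕ+ → Fin m} {n : ℕ} : pre x n = pre y n ↔ AA x n = AA y n := by
  induction n with
  | zero => simp [pre, AA]
  | succ n ih =>
    simp only [pre, AA]
    constructor
    · intro h
      obtain ⟨h1, h2⟩ := List.append_inj' h rfl
      simp only [List.cons.injEq, and_true] at h2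
      rw [ih.1 h1, h2]
    · intro h
      have hx := (x n.succPNat).2
      have hy := (y n.succPNat).2
      have h1 : (x n.succPNat : ℕ) = y n.succPNat := by
        have := congrArg (· % m) h
        simpa [Nat.mul_add_mod, Nat.mod_eq_of_lt hx, Nat.mod_eq_of_lt hy] using this
      rw [h1] at h
      have h2 : AA x n = AA y n :=
        Nat.eq_of_mul_eq_mul_left (by omega) (Nat.add_right_cancel h)
      rw [ih.2 h2, Fin.ext h1]

theorem AA_bounds {m : ℕ} (x : ℕ+ → Fin m) (n j : ℕ) :
    AA x n * m ^ j ≤ AA x (n + j) ∧ AA x (n + j) + 1 ≤ (AA x n + 1) * m ^ j := by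
  induction j with
  | zero => simp
  | succ j ih =>
    have hx := (x (n + j).succPNat).2
    rw [← add_assoc, AA, pow_succ]
    constructor
    · nlinarith [ih.1]
    · have := Nat.mul_le_mul_left m ih.2
      nlinarith

theorem val_summable {m : ℕ} (hm : 2 ≤ m) (x : ℕ+ → Fin m) :
    Summable (fun k : ℕ => ((x k.succPNat : ℕ) : ℝ) * (m : ℝ)⁻¹ ^ (k + 1)) := by
  have hm' : (2 : ℝ) ≤ m := by exact_mod_cast hm
  have h1 : Summable (fun k : ℕ => (m : ℝ)⁻¹ ^ k) :=
    summable_geometric_of_lt_one (by positivity) (inv_lt_one_of_one_lt₀ (by linarith))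
  refine Summable.of_nonneg_of_le (fun k => by positivity) (fun k => ?_) h1
  rw [pow_succ, mul_comm, mul_assoc]
  apply mul_le_of_le_one_right (by positivity)
  have : ((x k.succPNat : ℕ) : ℝ) ≤ m := by exact_mod_cast (x k.succPNat).2.le
  rw [inv_mul_le_iff₀ (by linarith)]
  linarith

theorem ValMap_eq {m : ℕ} (x : ℕ+ → Fin m) :
    ValMap m x = ∑' k : ℕ, ((x k.succPNat : ℕ) : ℝ) * (m : ℝ)⁻¹ ^ (k + 1) := by
  rw [ValMap, ← Equiv.pnatEquivNat.symm.tsum_eq]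
  rfl

theorem partial_eq {m : ℕ} (hm : 2 ≤ m) (x : ℕ+ → Fin m) (n : ℕ) :
    ∑ k ∈ Finset.range n, ((x k.succPNat : ℕ) : ℝ) * (m : ℝ)⁻¹ ^ (k + 1) =
      (AA x n : ℝ) / (m : ℝ) ^ n := by
  have hm' : (m : ℝ) ≠ 0 := by positivity
  induction n with
  | zero => simp [AA]
  | succ n ih =>
    rw [Finset.sum_range_succ, ih, AA]
    push_cast
    rw [inv_pow, pow_succ]
    field_simp

theorem val_bounds {m : ℕ} (hm : 2 ≤ m) (x : ℕ+ → Fin m) (n : ℕ) :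
    (AA x n : ℝ) ≤ (m : ℝ) ^ n * ValMap m x ∧ (m : ℝ) ^ n * ValMap m x ≤ AA x n + 1 := by
  have hm' : (0 : ℝ) < m := by positivity
  have h := (val_summable hm x).hasSum.tendsto_sum_nat
  rw [← ValMap_eq] at h
  simp only [partial_eq hm] at h
  have h2 := ((tendsto_add_atTop_iff_nat n).2 h).const_mul ((m : ℝ) ^ n)
  have e : ∀ j : ℕ, (m : ℝ) ^ n * ((AA x (j + n) : ℝ) / (m : ℝ) ^ (j + n)) =
      (AA x (n + j) : ℝ) / (m : ℝ) ^ j := by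
    intro j
    rw [pow_add, add_comm j n]
    field_simp
  simp only [e] at h2
  constructor
  · refine ge_of_tendsto' h2 (fun j => ?_)
    rw [le_div_iff₀ (by positivity)]
    exact_mod_cast (AA_bounds x n j).1
  · refine le_of_tendsto' h2 (fun j => ?_)
    rw [div_le_iff₀ (by positivity)]
    exact_mod_cast (Nat.le_succ _).trans (AA_bounds x n j).2

theorem val_close {m : ℕ} (hm : 2 ≤ m) {x y : ℕ+ → Fin m} {n : ℕ} (h : pre x n = pre y n) :
    |ValMap m x - ValMap m y| ≤ ((m : ℝ) ^ n)⁻¹ := by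
  have hm' : (0 : ℝ) < (m : ℝ) ^ n := by positivity
  have h1 := val_bounds hm x n
  have h2 := val_bounds hm y n
  rw [AA_congr.1 h] at h1
  rw [abs_le]
  constructor
  · rw [neg_le, inv_eq_one_div, le_div_iff₀ hm']; nlinarith
  · rw [inv_eq_one_div, le_div_iff₀ hm']; nlinarith

/-! ### The weights -/

theorem ext_append_left {m : ℕ} (hm : 0 < m) (w : List (Fin m)) (j : Fin m) (k : ℕ+)
    (hk : (k : ℕ) ≤ w.length) : ext hm (w ++ [j]) k = ext hm w k := by
  have := k.pos
  simp only [ext]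
  rw [List.getD_append _ _ _ _ (by omega)]

theorem ext_append_last {m : ℕ} (hm : 0 < m) (w : List (Fin m)) (j : Fin m) :
    ext hm (w ++ [j]) w.length.succPNat = j := by
  simp [ext]

/-- weight of the word `x₁…x_n` -/
def PW {m : ℕ} (q : ℕ+) (t : List (Fin m) → ℝ) (x : ℕ+ → Fin m) (n : ℕ) : ℝ :=
  ∏ k ∈ Finset.range n, (t (JP q x k.succPNat) / t (JM q x k.succPNat) ^ (q : ℕ))

theorem PW_congr {m : ℕ} {q : ℕ+} (hq : 2 ≤ (q : ℕ)) (t : List (Fin m) → ℝ) {x y : ℕ+ → Fin m}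
    {n : ℕ} (h : ∀ k : ℕ+, (k : ℕ) ≤ n → x k = y k) : PW q t x n = PW q t y n := by
  apply Finset.prod_congr rfl
  intro k hk
  rw [Finset.mem_range] at hk
  have h1 : JM q x k.succPNat = JM q y k.succPNat := by
    apply JM_congr hq
    intro j hj
    apply h
    have : (j : ℕ) < k + 1 := by exact_mod_cast hj
    omega
  rw [JP_eq hq, JP_eq hq, h1, h k.succPNat (by simpa using hk)]

theorem JM_ext {m : ℕ} (hm : 0 < m) {q : ℕ+} (hq : 2 ≤ (q : ℕ)) (x : ℕ+ → Fin m) (n : ℕ) :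
    JM q (ext hm (pre x n)) n.succPNat = JM q x n.succPNat := by
  apply JM_congr hq
  intro j hj
  apply ext_pre
  have : (j : ℕ) < n + 1 := by exact_mod_cast hj
  omega

theorem ch_sub {m : ℕ} (hm : 0 < m) {q : ℕ+} (hq : 2 ≤ (q : ℕ)) (Ω : Set (ℕ+ → Fin m))
    {n : ℕ} {w : List (Fin m)} (hw : w.length = n) :
    ch (XOm q Ω) w ⊆ ch Ω (JM q (ext hm w) n.succPNat) := by
  intro j hj
  rw [mem_ch] at hj ⊢
  obtain ⟨x, hx, h⟩ := mem_Pref' hj (n + 1) (by simp [hw])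
  rw [pre] at h
  obtain ⟨h1, h2⟩ := List.append_inj' h rfl
  simp only [List.cons.injEq, and_true] at h2
  rw [h1, h2, JM_ext hm hq, ← JP_eq hq]
  exact JP_mem hq hx _

theorem JM_ext_mem {m : ℕ} (hm : 0 < m) {q : ℕ+} (hq : 2 ≤ (q : ℕ)) {Ω : Set (ℕ+ → Fin m)}
    {n : ℕ} {w : List (Fin m)} (hw : w ∈ LF (XOm q Ω) n) :
    JM q (ext hm w) n.succPNat ∈ Pref Ω := by
  obtain ⟨x, hx, h⟩ := mem_Pref' (mem_LF.1 hw).2 n (mem_LF.1 hw).1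
  rw [h, JM_ext hm hq]
  exact JM_mem hq hx _

theorem PW_pos {m : ℕ} {q : ℕ+} (hq : 2 ≤ (q : ℕ)) {Ω : Set (ℕ+ → Fin m)}
    {t : List (Fin m) → ℝ} (ht : TSol q Ω t) {x : ℕ+ → Fin m} (hx : x ∈ XOm q Ω) (n : ℕ) :
    0 < PW q t x n := by
  apply Finset.prod_pos
  intro k _
  have h1 := (ht _ (JP_mem hq hx k.succPNat)).1.1
  have h2 := (ht _ (JM_mem hq hx k.succPNat)).1.1
  apply div_pos (by linarith)
  apply pow_pos
  linarith

theorem PW_ext {m : ℕ} (hm : 0 < m) {q : ℕ+} (hq : 2 ≤ (q : ℕ))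
    (t : List (Fin m) → ℝ) (x : ℕ+ → Fin m) (n : ℕ) :
    PW q t (ext hm (pre x n)) n = PW q t x n :=
  PW_congr hq t (fun k hk => ext_pre hm x n k hk)

theorem sum_PW_le {m : ℕ} (hm : 0 < m) {q : ℕ+} (hq : 2 ≤ (q : ℕ)) {Ω : Set (ℕ+ → Fin m)}
    (hne : Ω.Nonempty) {t : List (Fin m) → ℝ} (ht : TSol q Ω t) (n : ℕ) :
    ∑ w ∈ LF (XOm q Ω) n, PW q t (ext hm w) n ≤ 1 := by
  induction n with
  | zero => simp [LF_zero (XOm_nonempty hq hne), PW]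
  | succ n ih =>
    rw [sum_LF_succ]
    refine le_trans (Finset.sum_le_sum fun w hw => ?_) ih
    have hwl := (mem_LF.1 hw).1
    have hpos : 0 < PW q t (ext hm w) n := by
      obtain ⟨x, hx, h⟩ := mem_Pref' (mem_LF.1 hw).2 n hwl
      rw [h, PW_ext hm hq]
      exact PW_pos hq ht hx n
    set v := JM q (ext hm w) n.succPNat with hv
    have hvm : v ∈ Pref Ω := JM_ext_mem hm hq hw
    have e : ∀ j, PW q t (ext hm (w ++ [j])) (n + 1) =
        PW q t (ext hm w) n * (t (v ++ [j]) / t v ^ (q : ℕ)) := by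
      intro j
      have h1 : JM q (ext hm (w ++ [j])) n.succPNat = v := by
        apply JM_congr hq
        intro i hi
        apply ext_append_left
        have : (i : ℕ) < n + 1 := by exact_mod_cast hi
        omega
      have h2 : ext hm (w ++ [j]) n.succPNat = j := by rw [← hwl]; exact ext_append_last hm w j
      rw [PW, Finset.prod_range_succ, JP_eq hq, h1, h2]
      congr 1
      exact PW_congr hq t (fun k hk => ext_append_left hm w j k (by omega))
    simp only [e]
    rw [← Finset.mul_sum]
    apply mul_le_of_le_one_right hpos.le
    have hv0 : 0 < t v ^ (q : ℕ) := pow_pos (by linarith [(ht v hvm).1.1]) _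
    rw [← Finset.sum_div, div_le_one hv0, (ht v hvm).2]
    apply Finset.sum_le_sum_of_subset_of_nonneg (ch_sub hm hq Ω hwl)
    intro j hj _
    linarith [(ht _ (mem_ch.1 hj)).1.1]

/-- partial sums of `log t` along `x` -/
def SS {m : ℕ} (q : ℕ+) (t : List (Fin m) → ℝ) (x : ℕ+ → Fin m) (n : ℕ) : ℝ :=
  ∑ k ∈ Finset.range n, Real.log (t (JP q x k.succPNat))

theorem log_PW {m : ℕ} {q : ℕ+} (hq : 2 ≤ (q : ℕ)) {Ω : Set (ℕ+ → Fin m)}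
    {t : List (Fin m) → ℝ} (ht : TSol q Ω t) {x : ℕ+ → Fin m} (hx : x ∈ XOm q Ω) (n : ℕ) :
    Real.log (PW q t x (q * n)) =
      SS q t x (q * n) - q * (SS q t x n + ((q : ℝ) - 1) * n * Real.log (t [])) := by
  have h1 : ∀ k, t (JP q x k) ≠ 0 := fun k => by
    have := (ht _ (JP_mem hq hx k)).1.1
    linarith
  have h2 : ∀ k, t (JM q x k) ≠ 0 := fun k => by
    have := (ht _ (JM_mem hq hx k)).1.1
    linarith
  rw [PW, Real.log_prod (fun k _ => div_ne_zero (h1 _) (pow_ne_zero _ (h2 _)))]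
  have e : ∀ k ∈ Finset.range (q * n),
      Real.log (t (JP q x k.succPNat) / t (JM q x k.succPNat) ^ (q : ℕ)) =
      Real.log (t (JP q x k.succPNat)) - q * Real.log (t (JM q x k.succPNat)) := by
    intro k _
    rw [Real.log_div (h1 _) (pow_ne_zero _ (h2 _)), Real.log_pow]
  rw [Finset.sum_congr rfl e, Finset.sum_sub_distrib, ← Finset.mul_sum,
    block_sum q (fun k => Real.log (t (JM q x k))) (fun k => Real.log (t (JP q x k)))
      (Real.log (t [])) (fun k => by rw [JM_mul hq]) (fun k hk => by rw [JM_ndvd hq x k hk])]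
  rfl

theorem exists_good {m : ℕ} {q : ℕ+} (hq : 2 ≤ (q : ℕ)) {Ω : Set (ℕ+ → Fin m)}
    {t : List (Fin m) → ℝ} (ht : TSol q Ω t) {x : ℕ+ → Fin m} (hx : x ∈ XOm q Ω)
    {ε : ℝ} (hε : 0 < ε) (K0 : ℕ) :
    ∃ K : ℕ, Real.exp (-((q : ℝ) ^ (K0 + K + 1) * (((q : ℝ) - 1) * Real.log (t []) + ε))) ≤
      PW q t x ((q : ℕ) ^ (K0 + K + 1)) := by
  have hq0 : (0 : ℝ) < (q : ℕ) := by exact_mod_cast q.pos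
  by_contra! hcon
  set b : ℕ → ℝ := fun K => SS q t x ((q : ℕ) ^ K) / (q : ℝ) ^ K with hb
  have hb0 : ∀ K, 0 ≤ b K := fun K => by
    apply div_nonneg _ (by positivity)
    exact Finset.sum_nonneg (fun k _ => Real.log_nonneg (ht _ (JP_mem hq hx _)).1.1)
  have hstep : ∀ K, b (K0 + K + 1) ≤ b (K0 + K) - ε := by
    intro K
    have h1 := hcon K
    have h2 := Real.log_lt_log (PW_pos hq ht hx _) h1
    have e : (q : ℕ) ^ (K0 + K + 1) = q * (q : ℕ) ^ (K0 + K) := pow_succ' _ _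
    rw [Real.log_exp, e, log_PW hq ht hx, ← e] at h2
    have hp : (0 : ℝ) < (q : ℝ) ^ (K0 + K) := by positivity
    simp only [hb]
    rw [pow_succ' (q : ℝ), div_le_iff₀ (by positivity), sub_mul]
    have h3 : SS q t x ((q : ℕ) ^ (K0 + K)) / (q : ℝ) ^ (K0 + K) * ((q : ℝ) * (q : ℝ) ^ (K0 + K))
        = q * SS q t x ((q : ℕ) ^ (K0 + K)) := by field_simp
    rw [h3]
    push_cast at h2
    rw [pow_succ' (q : ℝ)] at h2
    nlinarith
  have hind : ∀ j : ℕ, b (K0 + j) ≤ b K0 - j * ε := by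
    intro j
    induction j with
    | zero => simp
    | succ j ih =>
      have := hstep j
      rw [← add_assoc]
      push_cast
      linarith
  obtain ⟨j, hj⟩ := exists_nat_gt (b K0 / ε)
  rw [div_lt_iff₀ hε] at hj
  linarith [hind j, hb0 (K0 + j)]


/-! ### Upper bound for the dimension -/

/-- the image of a cylinder -/
def XC {m : ℕ} (q : ℕ+) (Ω : Set (ℕ+ → Fin m)) (n : ℕ) (w : List (Fin m)) : Set ℝ :=
  ValMap m '' {x | x ∈ XOm q Ω ∧ pre x n = w}

theorem XC_diam {m : ℕ} (hm : 2 ≤ m) (q : ℕ+) (Ω : Set (ℕ+ → Fin m)) (n : ℕ)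
    (w : List (Fin m)) : Metric.ediam (XC q Ω n w) ≤ ENNReal.ofReal (((m : ℝ) ^ n)⁻¹) := by
  apply Metric.ediam_le
  rintro _ ⟨x, hx, rfl⟩ _ ⟨y, hy, rfl⟩
  rw [edist_dist, Real.dist_eq]
  apply ENNReal.ofReal_le_ofReal
  exact val_close hm (hx.2.trans hy.2.symm)

theorem dimH_upper {m : ℕ} (hm : 2 ≤ m) {q : ℕ+} (hq : 2 ≤ (q : ℕ)) {Ω : Set (ℕ+ → Fin m)}
    (hne : Ω.Nonempty) {t : List (Fin m) → ℝ} (ht : TSol q Ω t) {ε : ℝ} (hε : 0 < ε) :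
    dimH (XiSet (XOm q Ω)) ≤
      ENNReal.ofReal ((((q : ℝ) - 1) * Real.log (t []) + 2 * ε) / Real.log m) := by
  have hq' : (2 : ℝ) ≤ (q : ℕ) := by exact_mod_cast hq
  have hm' : (2 : ℝ) ≤ m := by exact_mod_cast hm
  have hm0 : 0 < m := by omega
  have hlogm : 0 < Real.log m := Real.log_pos (by linarith)
  have hnil : ([] : List (Fin m)) ∈ Pref Ω := by
    obtain ⟨x, hx⟩ := hne
    exact pre_mem hx 0
  have ht0 : 0 ≤ Real.log (t []) := Real.log_nonneg (ht _ hnil).1.1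
  set A := ((q : ℝ) - 1) * Real.log (t []) + ε with hA
  have hA0 : 0 < A := by
    have : 0 ≤ ((q : ℝ) - 1) * Real.log (t []) := mul_nonneg (by linarith) ht0
    linarith
  set s := (((q : ℝ) - 1) * Real.log (t []) + 2 * ε) / Real.log m with hs
  have hsm : s * Real.log m = A + ε := by rw [hs, hA]; field_simp; ring
  have hs0 : 0 < s := by
    rw [hs]; apply div_pos _ hlogm; linarith
  have key : μH[s] (XiSet (XOm q Ω)) ≠ ⊤ := by
    let ι : ℕ → Type := fun K0 => Σ K : ℕ, {w // w ∈ LF (XOm q Ω) ((q : ℕ) ^ (K0 + K + 1))}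
    let good : ℕ → List (Fin m) → Prop := fun K w =>
      Real.exp (-((q : ℝ) ^ K * A)) ≤ PW q t (ext hm0 w) ((q : ℕ) ^ K)
    let T : ∀ K0 : ℕ, ι K0 → Set ℝ := fun K0 p =>
      if good (K0 + p.1 + 1) p.2.1 then XC q Ω ((q : ℕ) ^ (K0 + p.1 + 1)) p.2.1 else ∅
    have hpl : ∀ K : ℕ, K ≤ (q : ℕ) ^ K := fun K => (Nat.lt_pow_self (by omega)).le
    have hr : Tendsto (fun K0 : ℕ => ENNReal.ofReal (((m : ℝ)⁻¹) ^ K0)) atTop (𝓝 0) := by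
      rw [← ENNReal.ofReal_zero]
      apply ENNReal.tendsto_ofReal
      exact tendsto_pow_atTop_nhds_zero_of_lt_one (by positivity)
        (inv_lt_one_of_one_lt₀ (by linarith))
    have h1 := Measure.hausdorffMeasure_le_liminf_tsum s (XiSet (XOm q Ω)) _ hr T
      (Eventually.of_forall (fun K0 p => by
        simp only [T]
        split_ifs
        · refine (XC_diam hm q Ω _ _).trans (ENNReal.ofReal_le_ofReal ?_)
          rw [← inv_pow]
          apply pow_le_pow_of_le_one (by positivity) (inv_le_one_of_one_le₀ (by linarith))
          have := hpl (K0 + p.1 + 1)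
          omega
        · simp))
      (Eventually.of_forall (fun K0 => by
        rintro _ ⟨x, hx, rfl⟩
        obtain ⟨K, hK⟩ := exists_good hq ht hx hε K0
        rw [Set.mem_iUnion]
        refine ⟨⟨K, pre x ((q : ℕ) ^ (K0 + K + 1)), mem_LF.2 ⟨pre_length _ _, pre_mem hx _⟩⟩, ?_⟩
        simp only [T]
        rw [if_pos]
        · exact ⟨x, ⟨hx, rfl⟩, rfl⟩
        · simp only [good]
          rw [PW_ext hm0 hq]
          exact hK))
    have h2 : ∀ K0 : ℕ, ∑' p : ι K0, Metric.ediam (T K0 p) ^ s ≤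
        ENNReal.ofReal (∑' K : ℕ, (Real.exp (-ε)) ^ K) := by
      intro K0
      have hgeo : Summable (fun K : ℕ => (Real.exp (-ε)) ^ K) :=
        summable_geometric_of_lt_one (Real.exp_pos _).le (by rw [Real.exp_lt_one_iff]; linarith)
      rw [ENNReal.tsum_sigma', ENNReal.ofReal_tsum_of_nonneg (fun K => by positivity) hgeo]
      apply ENNReal.tsum_le_tsum
      intro K
      set N := (q : ℕ) ^ (K0 + K + 1) with hN
      have hNr : ((q : ℝ) ^ (K0 + K + 1)) = (N : ℝ) := by rw [hN]; push_cast; rfl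
      have hw0 : ∀ w ∈ LF (XOm q Ω) N, 0 ≤ PW q t (ext hm0 w) N := by
        intro w hw
        obtain ⟨x, hx, h⟩ := mem_Pref' (mem_LF.1 hw).2 N (mem_LF.1 hw).1
        rw [h, PW_ext hm0 hq]
        exact (PW_pos hq ht hx N).le
      have hterm : ∀ w : {w // w ∈ LF (XOm q Ω) N}, Metric.ediam (T K0 ⟨K, w⟩) ^ s ≤
          ENNReal.ofReal (Real.exp (-(N * ε)) * PW q t (ext hm0 w.1) N) := by
        intro w
        simp only [T]
        split_ifs with hg
        · refine (ENNReal.rpow_le_rpow (XC_diam hm q Ω _ _) hs0.le).trans ?_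
          rw [ENNReal.ofReal_rpow_of_nonneg (by positivity) hs0.le]
          apply ENNReal.ofReal_le_ofReal
          simp only [good] at hg
          rw [hNr] at hg
          have e : (((m : ℝ) ^ N)⁻¹) ^ s = Real.exp (-(N * ε)) * Real.exp (-(N * A)) := by
            rw [← Real.exp_add, Real.rpow_def_of_pos (by positivity), Real.log_inv, Real.log_pow]
            congr 1
            linear_combination (-(N : ℝ)) * hsm
          rw [e]
          exact mul_le_mul_of_nonneg_left hg (Real.exp_pos _).le
        · simp [hs0]
      calc ∑' w : {w // w ∈ LF (XOm q Ω) N}, Metric.ediam (T K0 ⟨K, w⟩) ^ s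
          ≤ ∑' w : {w // w ∈ LF (XOm q Ω) N},
            ENNReal.ofReal (Real.exp (-(N * ε)) * PW q t (ext hm0 w.1) N) :=
            ENNReal.tsum_le_tsum hterm
        _ = ∑ w ∈ LF (XOm q Ω) N,
            ENNReal.ofReal (Real.exp (-(N * ε)) * PW q t (ext hm0 w) N) := by
            rw [tsum_fintype]
            exact Finset.sum_coe_sort (LF (XOm q Ω) N) (fun w =>
              ENNReal.ofReal (Real.exp (-(N * ε)) * PW q t (ext hm0 w) N))
        _ = ENNReal.ofReal (∑ w ∈ LF (XOm q Ω) N,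
            (Real.exp (-(N * ε)) * PW q t (ext hm0 w) N)) := by
            rw [ENNReal.ofReal_sum_of_nonneg]
            intro w hw
            exact mul_nonneg (Real.exp_pos _).le (hw0 w hw)
        _ ≤ ENNReal.ofReal ((Real.exp (-ε)) ^ K) := by
            apply ENNReal.ofReal_le_ofReal
            rw [← Finset.mul_sum]
            refine (mul_le_of_le_one_right (Real.exp_pos _).le
              (sum_PW_le hm0 hq hne ht N)).trans ?_
            rw [← Real.exp_nat_mul]
            apply Real.exp_le_exp.2
            have h3 : K ≤ N := by
              have := hpl (K0 + K + 1)
              omega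
            have h4 : (K : ℝ) ≤ N := by exact_mod_cast h3
            nlinarith
    have h3 : liminf (fun K0 => ∑' p : ι K0, Metric.ediam (T K0 p) ^ s) atTop ≤
        ENNReal.ofReal (∑' K : ℕ, (Real.exp (-ε)) ^ K) := by
      refine le_trans (liminf_le_liminf (Eventually.of_forall h2)) ?_
      simp
    exact ne_top_of_le_ne_top ENNReal.ofReal_ne_top (h1.trans h3)
  have := dimH_le_of_hausdorffMeasure_ne_top (d := s.toNNReal) (s := XiSet (XOm q Ω))
    (by rw [Real.coe_toNNReal s hs0.le]; exact key)
  exact this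

theorem dimH_upper' {m : ℕ} (hm : 2 ≤ m) {q : ℕ+} (hq : 2 ≤ (q : ℕ)) {Ω : Set (ℕ+ → Fin m)}
    (hne : Ω.Nonempty) {t : List (Fin m) → ℝ} (ht : TSol q Ω t) :
    dimH (XiSet (XOm q Ω)) ≤
      ENNReal.ofReal ((((q : ℝ) - 1) * Real.log (t [])) / Real.log m) := by
  have h : Tendsto (fun ε : ℝ => ENNReal.ofReal
      ((((q : ℝ) - 1) * Real.log (t []) + 2 * ε) / Real.log m)) (𝓝[>] 0)
      (𝓝 (ENNReal.ofReal ((((q : ℝ) - 1) * Real.log (t []) + 2 * 0) / Real.log m))) := by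
    apply ENNReal.tendsto_ofReal
    apply Tendsto.mono_left _ nhdsWithin_le_nhds
    apply Continuous.tendsto
    fun_prop
  rw [mul_zero, add_zero] at h
  refine ge_of_tendsto h ?_
  filter_upwards [self_mem_nhdsWithin] with ε hε
  exact dimH_upper hm hq hne ht hε


/-! ### Lower bound for the dimension in the symmetric case -/

theorem mem_of_pref {m : ℕ} {Ω : Set (ℕ+ → Fin m)} (hcl : IsClosed Ω) {x : ℕ+ → Fin m}
    (h : ∀ k, pre x k ∈ Pref Ω) : x ∈ Ω := by
  have : ∀ k, ∃ y ∈ Ω, pre x k = pre y k := fun k => mem_Pref' (h k) k (pre_length _ _)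
  choose y hy hy' using this
  refine hcl.mem_of_tendsto (f := y) (b := atTop) ?_ (Eventually.of_forall hy)
  rw [tendsto_pi_nhds]
  intro i
  apply tendsto_const_nhds.congr'
  filter_upwards [eventually_ge_atTop (i : ℕ)] with k hk
  exact (pre_congr' _ _ _).1 (hy' k) i hk

theorem exists_enum {m : ℕ} (hm : 0 < m) (Ω : Set (ℕ+ → Fin m)) :
    ∃ e : List (Fin m) → ℕ → Fin m, ∀ u,
      (∀ a < (ch Ω u).card, e u a ∈ ch Ω u) ∧
      (∀ a < (ch Ω u).card, ∀ b < (ch Ω u).card, e u a = e u b → a = b) := by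
  refine ⟨fun u a => if h : a < (ch Ω u).card then ((ch Ω u).equivFin.symm ⟨a, h⟩ : Fin m)
    else ⟨0, hm⟩, fun u => ⟨fun a ha => ?_, fun a ha b hb h => ?_⟩⟩
  · simp only [dif_pos ha]
    exact Subtype.prop _
  · simp only [dif_pos ha, dif_pos hb] at h
    have := (ch Ω u).equivFin.symm.injective (Subtype.ext h)
    simpa using this

/-- the path in the tree with choices `z` -/
def pz {m : ℕ} (e : List (Fin m) → ℕ → Fin m) (z : ℕ → ℕ) : ℕ → List (Fin m)
  | 0 => []
  | k + 1 => pz e z k ++ [e (pz e z k) (z k)]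

/-- the sequence with choices `z` -/
def al {m : ℕ} (e : List (Fin m) → ℕ → Fin m) (z : ℕ → ℕ) : ℕ+ → Fin m :=
  fun k => e (pz e z k.natPred) (z k.natPred)

theorem pre_al {m : ℕ} (e : List (Fin m) → ℕ → Fin m) (z : ℕ → ℕ) (k : ℕ) :
    pre (al e z) k = pz e z k := by
  induction k with
  | zero => rfl
  | succ k ih => simp [pre, pz, ih, al]

theorem pz_congr {m : ℕ} (e : List (Fin m) → ℕ → Fin m) {z z' : ℕ → ℕ} {k : ℕ}
    (h : ∀ l < k, z l = z' l) : pz e z k = pz e z' k := by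
  induction k with
  | zero => rfl
  | succ k ih =>
    rw [pz, pz, ih (fun l hl => h l (by omega)), h k (by omega)]

theorem pz_mem {m : ℕ} {Ω : Set (ℕ+ → Fin m)} (hne : Ω.Nonempty)
    {e : List (Fin m) → ℕ → Fin m}
    (he : ∀ u, ∀ a < (ch Ω u).card, e u a ∈ ch Ω u)
    {c : ℕ → ℕ} (hc : ∀ k, ∀ u ∈ LF Ω k, (ch Ω u).card = c k)
    {z : ℕ → ℕ} (hz : ∀ k, z k < c k) (k : ℕ) : pz e z k ∈ LF Ω k := by
  induction k with
  | zero => rw [LF_zero hne]; simp [pz]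
  | succ k ih =>
    rw [pz, mem_LF]
    refine ⟨by simp [(mem_LF.1 ih).1], ?_⟩
    rw [← mem_ch]
    apply he
    rw [hc k _ ih]
    exact hz k

theorem pz_inj {m : ℕ} {Ω : Set (ℕ+ → Fin m)} (hne : Ω.Nonempty)
    {e : List (Fin m) → ℕ → Fin m}
    (he : ∀ u, ∀ a < (ch Ω u).card, e u a ∈ ch Ω u)
    (he' : ∀ u, ∀ a < (ch Ω u).card, ∀ b < (ch Ω u).card, e u a = e u b → a = b)
    {c : ℕ → ℕ} (hc : ∀ k, ∀ u ∈ LF Ω k, (ch Ω u).card = c k)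
    {z z' : ℕ → ℕ} (hz : ∀ k, z k < c k) (hz' : ∀ k, z' k < c k) (k : ℕ)
    (h : pz e z (k + 1) = pz e z' (k + 1)) : z k = z' k := by
  rw [pz, pz] at h
  obtain ⟨h1, h2⟩ := List.append_inj' h rfl
  simp only [List.cons.injEq, and_true] at h2
  have hm := pz_mem hne he hc hz k
  rw [← h1] at h2
  exact he' _ _ (by rw [hc k _ hm]; exact hz k) _ (by rw [hc k _ hm]; exact hz' k) h2

def XZ {m : ℕ} (q : ℕ+) (e : List (Fin m) → ℕ → Fin m) {cc : ℕ+ → ℕ}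
    (z : (k : ℕ+) → Fin (cc k)) : ℕ+ → Fin m :=
  glue q (fun i => al e (fun l => (z (q ^ l * i) : ℕ)))

theorem XZ_mem {m : ℕ} {q : ℕ+} (hq : 2 ≤ (q : ℕ)) {Ω : Set (ℕ+ → Fin m)} (hne : Ω.Nonempty)
    (hcl : IsClosed Ω) {e : List (Fin m) → ℕ → Fin m}
    (he : ∀ u, ∀ a < (ch Ω u).card, e u a ∈ ch Ω u)
    {c : ℕ → ℕ} (hc : ∀ k, ∀ u ∈ LF Ω k, (ch Ω u).card = c k)
    (z : (k : ℕ+) → Fin (c (VV q k))) : XZ q e z ∈ XOm q Ω := by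
  intro i hi
  rw [XZ, RestrJ_glue hq _ i hi]
  apply mem_of_pref hcl
  intro k
  rw [pre_al]
  refine (mem_LF.1 (pz_mem hne he hc (fun l => ?_) k)).2
  have h2 := (VI_eq hq l i hi).1
  exact lt_of_lt_of_eq (z (q ^ l * i)).2 (congrArg c h2)

theorem XZ_inj {m : ℕ} {q : ℕ+} (hq : 2 ≤ (q : ℕ)) {Ω : Set (ℕ+ → Fin m)} (hne : Ω.Nonempty)
    {e : List (Fin m) → ℕ → Fin m}
    (he : ∀ u, ∀ a < (ch Ω u).card, e u a ∈ ch Ω u)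
    (he' : ∀ u, ∀ a < (ch Ω u).card, ∀ b < (ch Ω u).card, e u a = e u b → a = b)
    {c : ℕ → ℕ} (hc : ∀ k, ∀ u ∈ LF Ω k, (ch Ω u).card = c k)
    (z z' : (k : ℕ+) → Fin (c (VV q k))) (n : ℕ) (h : pre (XZ q e z) n = pre (XZ q e z') n)
    (k : ℕ+) (hk : (k : ℕ) ≤ n) : z k = z' k := by
  rw [pre_congr'] at h
  have h1 : JP q (XZ q e z) k = JP q (XZ q e z') k := by
    rw [JP_eq hq, JP_eq hq, h k hk, JM_congr hq (y := XZ q e z')]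
    intro j hj
    apply h
    have : (j : ℕ) < k := by exact_mod_cast hj
    omega
  have hi := (VI_spec hq k).2
  rw [JP, JP, XZ, XZ, RestrJ_glue hq _ _ hi, RestrJ_glue hq _ _ hi, pre_al, pre_al] at h1
  have hlt : ∀ (z : (k : ℕ+) → Fin (c (VV q k))) (l : ℕ), (z (q ^ l * II q k) : ℕ) < c l := by
    intro z l
    have h2 := (VI_eq hq l _ hi).1
    exact lt_of_lt_of_eq (z (q ^ l * II q k)).2 (congrArg c h2)
  have h2 := pz_inj hne he he' hc (hlt z) (hlt z') _ h1
  apply Fin.ext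
  have gen : ∀ k' : ℕ+, k' = k → (z k' : ℕ) = z' k' → (z k : ℕ) = z' k := by
    rintro _ rfl h; exact h
  exact gen _ (VI_spec hq k).1 h2

theorem XZ_congr {m : ℕ} {q : ℕ+} (hq : 2 ≤ (q : ℕ)) (e : List (Fin m) → ℕ → Fin m)
    {cc : ℕ+ → ℕ} (z z' : (k : ℕ+) → Fin (cc k)) (k : ℕ+) (h : ∀ j ≤ k, z j = z' j) :
    XZ q e z k = XZ q e z' k := by
  have hle : ∀ l ≤ VV q k, (z (q ^ l * II q k) : ℕ) = z' (q ^ l * II q k) := by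
    intro l hl
    rw [h]
    conv_rhs => rw [← (VI_spec hq k).1]
    rw [← PNat.coe_le_coe]
    simp only [PNat.mul_coe, PNat.pow_coe]
    exact Nat.mul_le_mul_right _ (Nat.pow_le_pow_right q.pos hl)
  simp only [XZ, glue, al, Nat.natPred_succPNat]
  rw [hle _ le_rfl, pz_congr e (fun l hl => hle l (by omega))]

theorem XZ_cont {m : ℕ} {q : ℕ+} (hq : 2 ≤ (q : ℕ)) (e : List (Fin m) → ℕ → Fin m)
    (cc : ℕ+ → ℕ) : Continuous (fun z : (k : ℕ+) → Fin (cc k) => XZ q e z) := by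
  refine continuous_pi (fun k => ?_)
  apply IsLocallyConstant.continuous
  rw [IsLocallyConstant.iff_exists_open]
  intro z
  refine ⟨Set.pi (Set.Iic k) (fun j => {z j}), isOpen_set_pi (Set.finite_Iic k)
    (fun j _ => isOpen_discrete _), fun j _ => rfl, fun z' hz' => ?_⟩
  exact XZ_congr hq e _ _ k (fun j hj => hz' j hj)

theorem Val_cont {m : ℕ} (hm : 2 ≤ m) : Continuous (fun x : ℕ+ → Fin m => ValMap m x) := by
  have hm' : (2 : ℝ) ≤ m := by exact_mod_cast hm
  simp only [ValMap_eq]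
  have h1 : Summable (fun k : ℕ => (m : ℝ)⁻¹ ^ k) :=
    summable_geometric_of_lt_one (by positivity) (inv_lt_one_of_one_lt₀ (by linarith))
  refine continuous_tsum (fun k => ?_) h1 (fun k x => ?_)
  · have : Continuous (fun a : Fin m => ((a : ℕ) : ℝ)) := continuous_of_discreteTopology
    have h3 : Continuous (fun x : ℕ+ → Fin m => ((x k.succPNat : ℕ) : ℝ)) :=
      this.comp (continuous_apply k.succPNat)
    exact h3.mul continuous_const
  · rw [Real.norm_of_nonneg (by positivity), pow_succ, mul_comm, mul_assoc]
    apply mul_le_of_le_one_right (by positivity)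
    have : ((x k.succPNat : ℕ) : ℝ) ≤ m := by exact_mod_cast (x k.succPNat).2.le
    rw [inv_mul_le_iff₀ (by linarith)]
    linarith

theorem card_X_le {m : ℕ} (hm : 0 < m) {q : ℕ+} (hq : 2 ≤ (q : ℕ)) {Ω : Set (ℕ+ → Fin m)}
    (hne : Ω.Nonempty) {c : ℕ → ℕ} (hc : ∀ k, ∀ u ∈ LF Ω k, (ch Ω u).card = c k) (n : ℕ) :
    (LF (XOm q Ω) n).card ≤ ∏ k ∈ Finset.range n, c (VV q k.succPNat) := by
  induction n with
  | zero => simp [LF_zero (XOm_nonempty hq hne)]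
  | succ n ih =>
    rw [LF_card_succ, Finset.prod_range_succ]
    refine le_trans (Finset.sum_le_card_nsmul _ _ (c (VV q n.succPNat)) (fun w hw => ?_)) ?_
    · rw [← hc _ (JM q (ext hm w) n.succPNat)
        (mem_LF.2 ⟨pre_length _ _, JM_ext_mem hm hq hw⟩)]
      exact Finset.card_le_card (ch_sub hm hq Ω (mem_LF.1 hw).1)
    · rw [smul_eq_mul]
      exact Nat.mul_le_mul_right _ ih

theorem exists_measure {m : ℕ} (hm : 2 ≤ m) {q : ℕ+} (hq : 2 ≤ (q : ℕ)) {Ω : Set (ℕ+ → Fin m)}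
    (hne : Ω.Nonempty) (hcl : IsClosed Ω) {c : ℕ → ℕ}
    (hc : ∀ k, ∀ u ∈ LF Ω k, (ch Ω u).card = c k) :
    ∃ ν : Measure ℝ, 1 ≤ ν (XiSet (XOm q Ω)) ∧
      ∀ (n : ℕ) (E : Set ℝ), Metric.ediam E ≤ ENNReal.ofReal (((m : ℝ) ^ n)⁻¹) →
        ν E ≤ 5 * ((LF (XOm q Ω) n).card : ℝ≥0∞)⁻¹ := by
  have hm0 : 0 < m := by omega
  obtain ⟨e, he0⟩ := exists_enum hm0 Ω
  have he := fun u => (he0 u).1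
  have he' := fun u => (he0 u).2
  have hcpos : ∀ k, 0 < c k := by
    intro k
    obtain ⟨u, hu⟩ := LF_nonempty hne k
    rw [← hc k u hu]
    exact (ch_nonempty (mem_LF.1 hu).2).card_pos
  have hnz : ∀ k : ℕ+, NeZero (c (VV q k)) := fun k => ⟨(hcpos _).ne'⟩
  let U : (k : ℕ+) → Measure (Fin (c (VV q k))) := fun k =>
    ProbabilityTheory.uniformOn Set.univ
  have hU : ∀ k, IsProbabilityMeasure (U k) := fun k =>
    ProbabilityTheory.isProbabilityMeasure_uniformOn Set.finite_univ Set.univ_nonempty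
  let Z := Measure.infinitePi U
  let G : ((k : ℕ+) → Fin (c (VV q k))) → ℝ := fun z => ValMap m (XZ q e z)
  have hG : Measurable G := ((Val_cont hm).comp (XZ_cont hq e _)).measurable
  have hcyl : ∀ n a, Z {z | AA (XZ q e z) n = a} ≤ ((LF (XOm q Ω) n).card : ℝ≥0∞)⁻¹ := by
    intro n a
    rcases Set.eq_empty_or_nonempty {z : (k : ℕ+) → Fin (c (VV q k)) | AA (XZ q e z) n = a}
      with h0 | ⟨z0, hz0⟩
    · rw [h0]; simp
    let S : Finset ℕ+ := (Finset.range n).map ⟨Nat.succPNat, Nat.succPNat_injective⟩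
    have hsub : {z : (k : ℕ+) → Fin (c (VV q k)) | AA (XZ q e z) n = a} ⊆
        Set.pi S (fun k => {z0 k}) := by
      intro z hz k hk
      have h1 : pre (XZ q e z) n = pre (XZ q e z0) n := AA_congr.2 (hz.trans hz0.symm)
      apply XZ_inj hq hne he he' hc z z0 n h1 k
      simp only [S, Finset.coe_map, Set.mem_image, Finset.mem_coe, Finset.mem_range] at hk
      obtain ⟨j, hj, rfl⟩ := hk
      simpa using hj
    refine (measure_mono hsub).trans ?_
    have h2 : Z (Set.pi S (fun k => {z0 k})) = ∏ k ∈ S, U k {z0 k} :=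
      Measure.infinitePi_pi U (fun _ _ => measurableSet_singleton _)
    rw [h2, Finset.prod_map]
    have h3 : ∀ k : ℕ+, U k {z0 k} = ((c (VV q k) : ℕ) : ℝ≥0∞)⁻¹ := by
      intro k
      simp only [U]
      rw [ProbabilityTheory.uniformOn_univ]
      simp
    simp only [h3, Function.Embedding.coeFn_mk]
    rw [← ENNReal.prod_inv_distrib (by
      intro i _ j _ _
      left
      exact_mod_cast (hcpos _).ne')]
    apply ENNReal.inv_le_inv.2
    exact_mod_cast card_X_le hm0 hq hne hc n
  have hclosed : ∀ (n : ℕ) (E : Set ℝ), IsClosed E →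
      Metric.ediam E ≤ ENNReal.ofReal (((m : ℝ) ^ n)⁻¹) →
        Z.map G E ≤ 5 * ((LF (XOm q Ω) n).card : ℝ≥0∞)⁻¹ := by
    intro n E hE hdiam
    rw [Measure.map_apply hG hE.measurableSet]
    rcases Set.eq_empty_or_nonempty (G ⁻¹' E) with h0 | ⟨z0, hz0⟩
    · rw [h0]; simp
    set a0 := AA (XZ q e z0) n with ha0
    have hsub : G ⁻¹' E ⊆ ⋃ r ∈ Finset.range 5, {z | AA (XZ q e z) n = a0 + r - 2} := by
      intro z hz
      have h1 : edist (G z) (G z0) ≤ ENNReal.ofReal (((m : ℝ) ^ n)⁻¹) :=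
        (Metric.edist_le_ediam_of_mem (s := E) (x := G z) (y := G z0) hz hz0).trans hdiam
      rw [edist_dist, ENNReal.ofReal_le_ofReal_iff (by positivity), Real.dist_eq, abs_le] at h1
      have hmn : (0 : ℝ) < (m : ℝ) ^ n := by positivity
      have hinv : (m : ℝ) ^ n * ((m : ℝ) ^ n)⁻¹ = 1 := mul_inv_cancel₀ hmn.ne'
      have b1 := val_bounds hm (XZ q e z) n
      have b2 := val_bounds hm (XZ q e z0) n
      have h2 : (AA (XZ q e z) n : ℝ) ≤ a0 + 2 := by
        have : (m : ℝ) ^ n * (G z - G z0) ≤ 1 := by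
          rw [← hinv]; exact mul_le_mul_of_nonneg_left h1.2 hmn.le
        have e1 : (m : ℝ) ^ n * (G z - G z0) = (m : ℝ) ^ n * ValMap m (XZ q e z) -
          (m : ℝ) ^ n * ValMap m (XZ q e z0) := mul_sub _ _ _
        linarith [b1.1, b2.2]
      have h3 : (a0 : ℝ) ≤ AA (XZ q e z) n + 2 := by
        have : -1 ≤ (m : ℝ) ^ n * (G z - G z0) := by
          have := mul_le_mul_of_nonneg_left h1.1 hmn.le
          rw [mul_neg, hinv] at this
          exact this
        have e1 : (m : ℝ) ^ n * (G z - G z0) = (m : ℝ) ^ n * ValMap m (XZ q e z) -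
          (m : ℝ) ^ n * ValMap m (XZ q e z0) := mul_sub _ _ _
        linarith [b1.2, b2.1]
      have h2' : AA (XZ q e z) n ≤ a0 + 2 := by exact_mod_cast h2
      have h3' : a0 ≤ AA (XZ q e z) n + 2 := by exact_mod_cast h3
      simp only [Set.mem_iUnion, Finset.mem_range]
      refine ⟨AA (XZ q e z) n + 2 - a0, by omega, ?_⟩
      show AA (XZ q e z) n = a0 + (AA (XZ q e z) n + 2 - a0) - 2
      omega
    refine (measure_mono hsub).trans ((measure_biUnion_finset_le _ _).trans ?_)
    refine (Finset.sum_le_card_nsmul _ _ _ (fun r _ => hcyl n _)).trans ?_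
    simp
  refine ⟨Z.map G, ?_, fun n E hE => ?_⟩
  · refine le_trans ?_ (Measure.le_map_apply hG.aemeasurable _)
    have : G ⁻¹' (XiSet (XOm q Ω)) = Set.univ := by
      ext z
      simp only [Set.mem_preimage, Set.mem_univ, iff_true]
      exact ⟨_, XZ_mem hq hne hcl he hc z, rfl⟩
    rw [this]
    simp [Z]
  · refine (measure_mono subset_closure).trans (hclosed n _ isClosed_closure ?_)
    rwa [Metric.ediam_closure]

theorem dimH_lower {m : ℕ} (hm : 2 ≤ m) {q : ℕ+} (hq : 2 ≤ (q : ℕ)) {Ω : Set (ℕ+ → Fin m)}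
    (hne : Ω.Nonempty) (hcl : IsClosed Ω) {c : ℕ → ℕ}
    (hc : ∀ k, ∀ u ∈ LF Ω k, (ch Ω u).card = c k) {d : ℝ}
    (hlim : Tendsto (fun n : ℕ => Real.logb m (NWords n (XOm q Ω)) / n) atTop (𝓝 d))
    {s : ℝ} (hs0 : 0 < s) (hsd : s < d) :
    ENNReal.ofReal s ≤ dimH (XiSet (XOm q Ω)) := by
  have hm' : (2 : ℝ) ≤ m := by exact_mod_cast hm
  have hmpos : (0 : ℝ) < m := by linarith
  obtain ⟨ν, hν1, hν2⟩ := exists_measure hm hq hne hcl hc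
  obtain ⟨n0, hn0⟩ := eventually_atTop.1
    ((hlim.eventually (lt_mem_nhds hsd)).and (eventually_gt_atTop 0))
  have hbound : ∀ n ≥ n0, ∀ E : Set ℝ, Metric.ediam E ≤ ENNReal.ofReal (((m : ℝ) ^ n)⁻¹) →
      ν E ≤ ENNReal.ofReal (5 * (((m : ℝ) ^ n)⁻¹) ^ s) := by
    intro n hn E hE
    refine (hν2 n E hE).trans ?_
    obtain ⟨h1, h2⟩ := hn0 n hn
    have h2' : (0 : ℝ) < n := by exact_mod_cast h2
    have hN := LFc_pos (XOm_nonempty hq hne) n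
    rw [NWords_eq, lt_div_iff₀ h2', Real.lt_logb_iff_rpow_lt (by linarith) hN] at h1
    rw [ENNReal.ofReal_mul (by norm_num)]
    have e5 : ENNReal.ofReal 5 = 5 := by simp
    rw [e5]
    gcongr
    rw [Real.inv_rpow (by positivity), ← Real.rpow_natCast, ← Real.rpow_mul hmpos.le, mul_comm,
      ENNReal.ofReal_inv_of_pos (by positivity)]
    apply ENNReal.inv_le_inv.2
    rw [← ENNReal.ofReal_natCast]
    exact ENNReal.ofReal_le_ofReal h1.le
  set C : ℝ := 5 * (m : ℝ) ^ s with hC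
  have hC0 : 0 < C := by positivity
  have hle : (ENNReal.ofReal C)⁻¹ • ν ≤ μH[s] := by
    apply Measure.le_hausdorffMeasure s _ (ENNReal.ofReal (((m : ℝ) ^ n0)⁻¹))
      (by rw [ENNReal.ofReal_pos]; positivity)
    intro E hE
    rw [Measure.smul_apply, smul_eq_mul, ENNReal.inv_mul_le_iff
      (by rw [ne_eq, ENNReal.ofReal_eq_zero]; linarith) ENNReal.ofReal_ne_top]
    have hfin : Metric.ediam E ≠ ⊤ := ne_top_of_le_ne_top ENNReal.ofReal_ne_top hE
    obtain ⟨δ, hδ0, hδ⟩ : ∃ δ : ℝ, 0 ≤ δ ∧ Metric.ediam E = ENNReal.ofReal δ :=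
      ⟨_, ENNReal.toReal_nonneg, (ENNReal.ofReal_toReal hfin).symm⟩
    rw [hδ, ENNReal.ofReal_le_ofReal_iff (by positivity)] at hE
    rcases hδ0.eq_or_lt with h0 | hpos
    · have hz : ν E ≤ 0 := by
        have hlim0 : Tendsto (fun n : ℕ => ENNReal.ofReal (5 * (((m : ℝ) ^ n)⁻¹) ^ s)) atTop
            (𝓝 0) := by
          rw [← ENNReal.ofReal_zero]
          apply ENNReal.tendsto_ofReal
          have : Tendsto (fun n : ℕ => 5 * ((((m : ℝ)⁻¹) ^ s) ^ n)) atTop (𝓝 (5 * 0)) := by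
            apply Tendsto.const_mul
            apply tendsto_pow_atTop_nhds_zero_of_lt_one (by positivity)
            exact Real.rpow_lt_one (by positivity) (inv_lt_one_of_one_lt₀ (by linarith)) hs0
          rw [mul_zero] at this
          refine this.congr (fun n => ?_)
          rw [← inv_pow, ← Real.rpow_natCast, ← Real.rpow_natCast, ← Real.rpow_mul (by positivity),
            ← Real.rpow_mul (by positivity), mul_comm s]
        refine ge_of_tendsto hlim0 ?_
        filter_upwards [eventually_ge_atTop n0] with n hn
        apply hbound n hn
        rw [hδ, ← h0]
        simp
      exact hz.trans zero_le
    · have hy1 : (m : ℝ)⁻¹ < 1 := inv_lt_one_of_one_lt₀ (by linarith)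
      have hE1 : δ ≤ 1 := hE.trans (inv_le_one_of_one_le₀ (one_le_pow₀ (by linarith)))
      obtain ⟨n, hn1, hn2⟩ := exists_nat_pow_near_of_lt_one hpos hE1 (inv_pos.2 hmpos) hy1
      have hnn : n0 ≤ n := by
        by_contra hcon
        have h1 : ((m : ℝ)⁻¹) ^ n0 ≤ ((m : ℝ)⁻¹) ^ (n + 1) :=
          pow_le_pow_of_le_one (by positivity) hy1.le (by omega)
        rw [inv_pow (m : ℝ) n0] at h1
        linarith
      have h3 := hbound n hnn E (by
        rw [hδ, ← inv_pow]; exact ENNReal.ofReal_le_ofReal hn2)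
      refine h3.trans ?_
      rw [hδ, ENNReal.ofReal_rpow_of_nonneg hδ0 hs0.le, ← ENNReal.ofReal_mul hC0.le]
      apply ENNReal.ofReal_le_ofReal
      rw [hC, mul_assoc, ← Real.mul_rpow hmpos.le hδ0]
      apply mul_le_mul_of_nonneg_left _ (by norm_num)
      apply Real.rpow_le_rpow (by positivity) _ hs0.le
      rw [pow_succ', inv_mul_lt_iff₀ hmpos, inv_pow] at hn1
      exact hn1.le
  have hne0 : μH[s] (XiSet (XOm q Ω)) ≠ 0 := by
    intro h0
    have h1 := hle (XiSet (XOm q Ω))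
    rw [h0, Measure.smul_apply, smul_eq_mul, nonpos_iff_eq_zero, mul_eq_zero] at h1
    rcases h1 with h1 | h1
    · rw [ENNReal.inv_eq_zero] at h1
      exact ENNReal.ofReal_ne_top h1
    · rw [h1] at hν1
      simp at hν1
  exact le_dimH_of_hausdorffMeasure_ne_zero (d := s.toNNReal) (s := XiSet (XOm q Ω))
    (by rw [Real.coe_toNNReal s hs0.le]; exact hne0)

/-- **Theorem 2.2 (ii), second part.** `dim_H(Ξ_Ω) = dim_M(X_Ω)` iff the tree of prefixes of
`Ω` is spherically symmetric. -/
theorem stmt9 (m : ℕ) (hm : 2 ≤ m) (q : ℕ+) (hq : 2 ≤ (q : ℕ))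
    (Ω : Set (ℕ+ → Fin m)) (hne : Ω.Nonempty) (hcl : IsClosed Ω)
    (d : ℝ)
    (hlim : Tendsto (fun n : ℕ => Real.logb m (NWords n (XOm q Ω)) / n) atTop (𝓝 d)) :
    dimH (XiSet (XOm q Ω)) = ENNReal.ofReal d ↔
      ∀ k : ℕ, 1 ≤ k → ∃ c : ℕ, ∀ u : List (Fin m), u.length = k → u ∈ Pref Ω →
        Set.ncard {j : Fin m | u ++ [j] ∈ Pref Ω} = c := by
  have hm' : (2 : ℝ) ≤ m := by exact_mod_cast hm
  have hq' : (2 : ℝ) ≤ (q : ℕ) := by exact_mod_cast hq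
  have hlogm : 0 < Real.log m := Real.log_pos (by linarith)
  obtain ⟨t, ht⟩ := exists_TSol hm hq Ω
  have hup := dimH_upper' hm hq hne ht
  constructor
  · intro hdim
    have hconst : ∀ k, ∀ u ∈ LF Ω k, ∀ v ∈ LF Ω k, t u = t v := by
      by_contra! hcon
      obtain ⟨k, u, hu, v, hv, huv⟩ := hcon
      have hlt := dl_lt hq hne ht k ⟨u, hu, v, hv, huv⟩
      set η := dl Ω t (k + 1) + HH Ω (k + 1) - HH Ω k - (q : ℕ) * dl Ω t k with hη
      have hη0 : 0 < η := by linarith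
      have hge := d_ge hm hq hne hlim ht k η (by rw [hη]; linarith)
      rw [dl_zero hne] at hge
      have hnil : ([] : List (Fin m)) ∈ Pref Ω := by
        obtain ⟨x, hx⟩ := hne
        exact pre_mem hx 0
      have ht0 : 0 ≤ Real.log (t []) := Real.log_nonneg (ht _ hnil).1.1
      have hslack : 0 < ((q : ℝ) - 1) * (η / (q : ℝ) ^ (k + 1)) := by
        apply mul_pos (by linarith)
        positivity
      have hlt' : (((q : ℝ) - 1) * Real.log (t [])) / Real.log m < d := by
        rw [div_lt_iff₀ hlogm]
        linarith
      have h0 : 0 ≤ (((q : ℝ) - 1) * Real.log (t [])) / Real.log m :=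
        div_nonneg (mul_nonneg (by linarith) ht0) hlogm.le
      rw [hdim] at hup
      have := (ENNReal.ofReal_lt_ofReal_iff (lt_of_le_of_lt h0 hlt')).2 hlt'
      exact absurd hup (not_le.2 this)
    intro k _
    obtain ⟨v, hv⟩ := LF_nonempty hne k
    refine ⟨(ch Ω v).card, fun u hu hu' => ?_⟩
    rw [ncard_ch]
    exact sym_of_const ht hconst k u (mem_LF.2 ⟨hu, hu'⟩) v hv
  · intro hsym
    have hsym' : ∀ k, ∃ c : ℕ, ∀ u ∈ LF Ω k, (ch Ω u).card = c := by
      intro k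
      rcases Nat.eq_zero_or_pos k with rfl | hk
      · refine ⟨(ch Ω []).card, fun u hu => ?_⟩
        rw [LF_zero hne, Finset.mem_singleton] at hu
        rw [hu]
      · obtain ⟨c, hc⟩ := hsym k hk
        refine ⟨c, fun u hu => ?_⟩
        rw [← ncard_ch]
        exact hc u (mem_LF.1 hu).1 (mem_LF.1 hu).2
    choose c hc using hsym'
    apply le_antisymm
    · refine hup.trans (ENNReal.ofReal_le_ofReal ?_)
      have hge := d_ge hm hq hne hlim ht 0 0 (by rw [add_zero]; exact dl_le hne ht 0)
      rw [dl_zero hne, zero_div, add_zero] at hge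
      rw [div_le_iff₀ hlogm]
      exact hge
    · apply le_of_forall_lt
      intro a ha
      have ha' : a ≠ ⊤ := ne_top_of_lt ha
      have h1 : a.toReal < d := by
        rw [ENNReal.lt_ofReal_iff_toReal_lt ha'] at ha
        exact ha
      obtain ⟨s, hs1, hs2⟩ := exists_between h1
      have hs0 : 0 < s := lt_of_le_of_lt ENNReal.toReal_nonneg hs1
      refine lt_of_lt_of_le ?_ (dimH_lower hm hq hne hcl hc hlim hs0 hs2)
      rw [ENNReal.lt_ofReal_iff_toReal_lt ha']
      exact hs1
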